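/- Let N be an infinite-dimensional factor acting on a separable Hilbert space (equivalently, a separably represented factor of type I_∞, II, or III), let (p_n) be a decreasing sequence of nonzero projections in N converging to 0 in the weak operator topology, and let C be a von Neumann subalgebra of N with the same unit. Then there exist a singular pure state f on N and a projection q ∈ C such that f(p_n) = 1 for all n, and either (1) 0 < f(q) < 1, or (2) q is a minimal projection of C, q is central in C, and f(q) = 1. -/

import Mathlib

open scoped ComplexOrder InnerProductSpace
open Filter Topology

noncomputable instance {H : Type*} [NormedAddCommGroup H] [InnerProductSpace ℂ H]
    [CompleteSpace H] : SMulMemClass (VonNeumannAlgebra H) ℂ (H →L[ℂ] H) :=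
  ⟨fun {s} c {_} hx => s.toStarSubalgebra.smul_mem hx c⟩

/-- The σ-weak (ultraweak, weak*) topology on `B(H)`: the initial topology induced by the
functionals `x ↦ ∑' n, ⟪ξ n, x (η n)⟫` over all pairs of square-summable sequences. -/
noncomputable def sigmaWeak (H : Type*) [NormedAddCommGroup H] [InnerProductSpace ℂ H]
    [CompleteSpace H] : TopologicalSpace (H →L[ℂ] H) :=
  ⨅ (ξ : ℕ → H) (η : ℕ → H) (_ : Summable fun n => ‖ξ n‖ ^ 2)
    (_ : Summable fun n => ‖η n‖ ^ 2),
    TopologicalSpace.induced (fun x : H →L[ℂ] H => ∑' n, ⟪ξ n, x (η n)⟫_ℂ) inferInstance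

variable {H : Type*} [NormedAddCommGroup H] [InnerProductSpace ℂ H] [CompleteSpace H]

/-- A positive linear functional on a von Neumann algebra. -/
def IsPosFunctional (M : VonNeumannAlgebra H) (f : ↥M →ₗ[ℂ] ℂ) : Prop :=
  ∀ a : ↥M, 0 ≤ f (star a * a)

/-- A state on a von Neumann algebra: a positive linear functional sending `1` to `1`. -/
def IsStateOn (M : VonNeumannAlgebra H) (f : ↥M →ₗ[ℂ] ℂ) : Prop :=
  IsPosFunctional M f ∧ f 1 = 1

/-- A pure state: a state such that every positive linear functional it dominates is a
nonnegative scalar multiple of it. -/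
def IsPureStateOn (M : VonNeumannAlgebra H) (f : ↥M →ₗ[ℂ] ℂ) : Prop :=
  IsStateOn M f ∧ ∀ g : ↥M →ₗ[ℂ] ℂ, IsPosFunctional M g → IsPosFunctional M (f - g) →
    ∃ t : ℝ, 0 ≤ t ∧ g = (t : ℂ) • f

/-- A functional on a von Neumann algebra is normal if it is continuous for the σ-weak
topology. -/
def IsNormalOn (M : VonNeumannAlgebra H) (f : ↥M →ₗ[ℂ] ℂ) : Prop :=
  @Continuous ↥M ℂ
    (TopologicalSpace.induced (fun x : ↥M => (x : H →L[ℂ] H)) (sigmaWeak H)) _ f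

/-- A state on a von Neumann algebra is singular if the only normal positive linear
functional it dominates is `0`. -/
def IsSingularOn (M : VonNeumannAlgebra H) (f : ↥M →ₗ[ℂ] ℂ) : Prop :=
  ∀ g : ↥M →ₗ[ℂ] ℂ, IsPosFunctional M g → IsPosFunctional M (f - g) → IsNormalOn M g → g = 0

/-- A projection: a self-adjoint idempotent. -/
def IsProjection (p : H →L[ℂ] H) : Prop := star p = p ∧ p * p = p

/-- `q` is a subprojection of `p` (i.e. `q ≤ p` for projections). -/
def ProjLE (q p : H →L[ℂ] H) : Prop := q * p = q ∧ p * q = q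

/-- `p` is a minimal projection of the set `S`: a nonzero projection in `S` such that the
only projections of `S` below `p` are `0` and `p`. -/
def IsMinimalProjectionIn (S : Set (H →L[ℂ] H)) (p : H →L[ℂ] H) : Prop :=
  p ∈ S ∧ IsProjection p ∧ p ≠ 0 ∧
    ∀ q ∈ S, IsProjection q → ProjLE q p → q = 0 ∨ q = p

/-- `f` is multiplicative on the subset `C` of `M`. -/
def IsMultiplicativeOn (M : VonNeumannAlgebra H) (f : ↥M →ₗ[ℂ] ℂ)
    (C : Set (H →L[ℂ] H)) : Prop :=
  ∀ a b : ↥M, (a : H →L[ℂ] H) ∈ C → (b : H →L[ℂ] H) ∈ C → f (a * b) = f a * f b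

/-- `f` is normal on the von Neumann subalgebra `C` of `M` (where `C ⊆ M`): the restriction
of `f` to `C` is σ-weakly continuous. -/
def IsNormalOnSub (M : VonNeumannAlgebra H) (f : ↥M →ₗ[ℂ] ℂ) (C : VonNeumannAlgebra H)
    (hC : (C : Set (H →L[ℂ] H)) ⊆ M) : Prop :=
  @Continuous ↥C ℂ
    (TopologicalSpace.induced (fun x : ↥C => (x : H →L[ℂ] H)) (sigmaWeak H)) _
    (fun x => f ⟨x, hC x.2⟩)

/-- A state on `M` is classically normal if it is normal on every von Neumann subalgebra
of `M` (with the same unit) on which it is multiplicative. -/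
def IsClassicallyNormalOn (M : VonNeumannAlgebra H) (f : ↥M →ₗ[ℂ] ℂ) : Prop :=
  ∀ (C : VonNeumannAlgebra H) (hC : (C : Set (H →L[ℂ] H)) ⊆ M),
    IsMultiplicativeOn M f (C : Set (H →L[ℂ] H)) → IsNormalOnSub M f C hC

/-- A von Neumann algebra is a factor if its center consists of the scalar multiples of
the identity. -/
def IsFactor (N : VonNeumannAlgebra H) : Prop :=
  ∀ x ∈ N, (∀ y ∈ N, x * y = y * x) → ∃ c : ℂ, x = c • (1 : H →L[ℂ] H)

/-- A positive operator on a Hilbert space. -/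
def IsPositiveOp (a : H →L[ℂ] H) : Prop :=
  star a = a ∧ ∀ v : H, 0 ≤ ⟪v, a v⟫_ℂ

theorem VonNeumannAlgebra.cfc_mem (N : VonNeumannAlgebra H) {y : H →L[ℂ] H} (hy : y ∈ N)
    (hsa : IsSelfAdjoint y) (k : ℝ → ℝ) : cfc k y ∈ N := by
  rw [← N.commutant_commutant, VonNeumannAlgebra.mem_commutant_iff]
  intro g hg
  exact ((hsa.commute_cfc (VonNeumannAlgebra.mem_commutant_iff.1 hg y hy) k).eq).symm

/-- The projection onto the closure of a subspace invariant under the commutant. -/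
theorem VonNeumannAlgebra.starProjection_topologicalClosure_mem (N : VonNeumannAlgebra H)
    (K : Submodule ℂ H) (hK : ∀ y ∈ N.commutant, ∀ v ∈ K, y v ∈ K) :
    K.topologicalClosure.starProjection ∈ N := by
  rw [VonNeumannAlgebra.IsStarProjection.mem_iff isStarProjection_starProjection]
  intro y hy
  rw [Submodule.range_starProjection, Module.End.mem_invtSubmodule]
  intro v hv
  exact map_mem_closure y.continuous hv (hK y hy)

/-- The projection onto the closure of the range of an element of a von Neumann algebra. -/
theorem VonNeumannAlgebra.exists_rangeProjection (N : VonNeumannAlgebra H) {a : H →L[ℂ] H}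
    (ha : a ∈ N) :
    ∃ s ∈ N, IsStarProjection s ∧ s * a = a ∧ (∀ b : H →L[ℂ] H, b * a = 0 → b * s = 0) ∧
      ∀ v, s v ∈ closure (Set.range a) := by
  have hmem (v : H) : (a.range.topologicalClosure.starProjection v) ∈ closure (Set.range a) := by
    exact (a.range.topologicalClosure).starProjection_apply_mem v
  refine ⟨a.range.topologicalClosure.starProjection,
    N.starProjection_topologicalClosure_mem _ ?_, isStarProjection_starProjection, ?_, ?_, hmem⟩
  · rintro y hy _ ⟨v, rfl⟩
    exact ⟨y v, DFunLike.congr_fun (VonNeumannAlgebra.mem_commutant_iff.1 hy a ha) v⟩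
  · ext v
    exact Submodule.starProjection_eq_self_iff.2 (Submodule.le_topologicalClosure _ ⟨v, rfl⟩)
  · intro b hb
    ext v
    have : IsClosed {x | b x = 0} := isClosed_eq b.continuous continuous_const
    refine closure_minimal ?_ this (hmem v)
    rintro _ ⟨w, rfl⟩
    exact DFunLike.congr_fun hb w

/-- A factor is a prime ring. -/
theorem IsFactor.exists_mul_mul_ne_zero {N : VonNeumannAlgebra H} (hfac : IsFactor N)
    {a b : H →L[ℂ] H} (ha : a ≠ 0) (hb : b ∈ N) (hb0 : b ≠ 0) :
    ∃ w ∈ N, a * w * b ≠ 0 := by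
  by_contra! h
  set K : Submodule ℂ H := Submodule.span ℂ {x | ∃ w ∈ N, ∃ v, x = w (b v)} with hKdef
  set z := K.topologicalClosure.starProjection with hz
  have hinv (y : H →L[ℂ] H) (hy : ∀ w ∈ N, ∀ v, y (w (b v)) ∈ K) : ∀ v ∈ K, y v ∈ K := by
    intro v hv
    have : K ≤ K.comap (y : H →ₗ[ℂ] H) := by
      conv_lhs => rw [hKdef]
      rw [Submodule.span_le]
      rintro _ ⟨w, hw, v, rfl⟩
      exact hy w hw v
    exact this hv
  have hzN : z ∈ N := by
    refine N.starProjection_topologicalClosure_mem K fun y hy => hinv y fun w hw v => ?_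
    refine Submodule.subset_span ⟨w, hw, y v, ?_⟩
    have h1 := DFunLike.congr_fun (VonNeumannAlgebra.mem_commutant_iff.1 hy w hw) (b v)
    have h2 := DFunLike.congr_fun (VonNeumannAlgebra.mem_commutant_iff.1 hy b hb) v
    simp only [mul_apply_eq_comp] at h1 h2
    rw [h2, h1]
  have hzN' : z ∈ N.commutant := by
    refine N.commutant.starProjection_topologicalClosure_mem K fun y hy => hinv y
      fun w hw v => ?_
    rw [N.commutant_commutant] at hy
    exact Submodule.subset_span ⟨y * w, mul_mem hy hw, v, rfl⟩
  obtain ⟨c, hc⟩ := hfac z hzN fun y hy => (VonNeumannAlgebra.mem_commutant_iff.1 hzN' y hy).symm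
  have hzb (v : H) : z (b v) = b v := by
    refine Submodule.starProjection_eq_self_iff.2 (Submodule.le_topologicalClosure _ ?_)
    exact Submodule.subset_span ⟨1, one_mem N, v, rfl⟩
  have hc1 : c = 1 := by
    obtain ⟨v, hv⟩ := DFunLike.ne_iff.1 hb0
    have := hzb v
    rw [hc] at this
    simp only [smul_apply, one_apply_eq_self] at this
    have h3 : (c - 1) • b v = 0 := by rw [sub_smul, this, one_smul, sub_self]
    rcases smul_eq_zero.1 h3 with h4 | h4
    · exact sub_eq_zero.1 h4
    · exact absurd h4 hv
  apply ha
  ext v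
  have hvK : v ∈ K.topologicalClosure := by
    rw [← Submodule.starProjection_eq_self_iff, ← hz, hc, hc1]
    simp
  have hcl : IsClosed {x | a x = 0} := isClosed_eq a.continuous continuous_const
  refine closure_minimal ?_ hcl hvK
  have : K ≤ LinearMap.ker (a : H →ₗ[ℂ] H) := by
    rw [hKdef, Submodule.span_le]
    rintro _ ⟨w, hw, v, rfl⟩
    exact DFunLike.congr_fun (h w hw) v
  exact this

/-- A positive element `y` of norm larger than `ε` has a nonzero multiple in its functional
calculus on whose range `y` is bounded below by `ε`. -/
theorem VonNeumannAlgebra.exists_spectral_cutoff (N : VonNeumannAlgebra H) {y : H →L[ℂ] H}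
    (hy : y ∈ N) (hpos : 0 ≤ y) {ε : ℝ} (hε : 0 < ε) (hn : ε < ‖y‖) :
    ∃ a b : H →L[ℂ] H, a ∈ N ∧ a ≠ 0 ∧ IsSelfAdjoint a ∧ a = y * b ∧ a = b * y ∧
      ∀ v, ε * ‖a v‖ ^ 2 ≤ RCLike.re ⟪y (a v), a v⟫_ℂ := by
  have hsa : IsSelfAdjoint y := IsSelfAdjoint.of_nonneg hpos
  set k : ℝ → ℝ := fun t => max (t - ε) 0 with hk
  have hkc : Continuous k := by fun_prop
  have hid : cfc (fun t : ℝ => t) y = y := cfc_id' ℝ y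
  have hyb : y * cfc k y = cfc (fun t => t * k t) y := by
    rw [cfc_mul (fun t : ℝ => t) k y (by fun_prop) hkc.continuousOn, hid]
  have hby : cfc k y * y = cfc (fun t => t * k t) y := by
    simp_rw [mul_comm _ (k _)]
    rw [cfc_mul k (fun t : ℝ => t) y hkc.continuousOn (by fun_prop), hid]
  have ha : IsSelfAdjoint (cfc (fun t => t * k t) y) := cfc_predicate _ y
  refine ⟨cfc (fun t => t * k t) y, cfc k y, N.cfc_mem hy hsa _, ?_, ha, hyb.symm, hby.symm, ?_⟩
  · intro h0
    have hsp : ∀ t ∈ spectrum ℝ y, t * k t = 0 := by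
      intro t ht
      have h2 : cfc (fun t => t * k t) y = cfc (fun _ => (0 : ℝ)) y := by rw [h0]; simp
      exact (cfc_eq_cfc_iff_eqOn (R := ℝ) (a := y) (by cfc_tac)
        (by fun_prop) (by fun_prop)).1 h2 ht
    have : ‖cfc (fun t : ℝ => t) y‖ ≤ ε := by
      refine norm_cfc_le hε.le fun t ht => ?_
      have h1 := spectrum_nonneg_of_nonneg hpos ht
      rw [Real.norm_of_nonneg h1]
      by_contra! hlt
      have h2 := hsp t ht
      have h3 : k t = t - ε := max_eq_left (by linarith)
      rw [h3] at h2
      have := mul_pos (hε.trans hlt) (sub_pos.2 hlt)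
      linarith
    rw [hid] at this
    linarith
  · intro v
    set a := cfc (fun t => t * k t) y
    have hnn : 0 ≤ a * y * a - ε • (a * a) := by
      have : a * y * a - ε • (a * a) = cfc (fun t => (t * k t) * (t - ε) * (t * k t)) y := by
        rw [cfc_mul (fun t => (t * k t) * (t - ε)) (fun t => t * k t) y (by fun_prop)
          (by fun_prop), cfc_mul (fun t => (t * k t)) (fun t => t - ε) y (by fun_prop)
          (by fun_prop), cfc_sub (fun t : ℝ => t) (fun _ => ε) y, hid, cfc_const ε y,
          mul_sub, sub_mul, Algebra.algebraMap_eq_smul_one]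
        simp [a]
      rw [this]
      refine cfc_nonneg fun t ht => ?_
      have h1 := spectrum_nonneg_of_nonneg hpos ht
      by_cases h2 : t ≤ ε
      · have : k t = 0 := max_eq_right (by linarith)
        simp [this]
      · have : k t = t - ε := max_eq_left (by linarith)
        rw [this]
        have : 0 ≤ t - ε := by linarith
        positivity
    have h1 := ((ContinuousLinearMap.nonneg_iff_isPositive _).1 hnn).re_inner_nonneg_left v
    have h2 : ⟪(a * y * a) v, v⟫_ℂ = ⟪y (a v), a v⟫_ℂ := by
      simp only [mul_apply_eq_comp]
      rw [← ContinuousLinearMap.adjoint_inner_right, ← ContinuousLinearMap.star_eq_adjoint,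
        ha.star_eq]
    have h3 : ⟪(a * a) v, v⟫_ℂ = ⟪a v, a v⟫_ℂ := by
      simp only [mul_apply_eq_comp]
      rw [← ContinuousLinearMap.adjoint_inner_right, ← ContinuousLinearMap.star_eq_adjoint,
        ha.star_eq]
    have h4 : (ε • (a * a)) v = (ε : ℂ) • (a * a) v := by simp
    rw [sub_apply, inner_sub_left, h2, h4, inner_smul_left, h3,
      inner_self_eq_norm_sq_to_K] at h1
    simp only [map_sub, sub_nonneg] at h1
    refine le_trans (le_of_eq ?_) h1
    rw [Complex.conj_ofReal]
    change _ = Complex.re ((ε : ℂ) * ((‖a v‖ : ℝ) : ℂ) ^ 2)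
    rw [← Complex.ofReal_pow, ← Complex.ofReal_mul, Complex.ofReal_re]

theorem IsPosFunctional.conj_apply_star_mul {N : VonNeumannAlgebra H} {f : ↥N →ₗ[ℂ] ℂ}
    (hf : IsPosFunctional N f) (x y : ↥N) :
    (starRingEnd ℂ) (f (star y * x)) = f (star x * y) := by
  have him (a : ↥N) : (f (star a * a)).im = 0 := ((Complex.nonneg_iff.1 (hf a)).2).symm
  have h1 : (f (star (x + y) * (x + y))).im =
      (f (star x * x)).im + (f (star y * y)).im + (f (star x * y)).im + (f (star y * x)).im := by
    have : star (x + y) * (x + y) = star x * x + star y * y + star x * y + star y * x := by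
      rw [star_add]; noncomm_ring
    rw [this]; simp
  have h2 : (f (star (x + Complex.I • y) * (x + Complex.I • y))).im =
      (f (star x * x)).im + (f (star y * y)).im + (f (star x * y)).re - (f (star y * x)).re := by
    have : star (x + Complex.I • y) * (x + Complex.I • y) =
        star x * x + star y * y + Complex.I • (star x * y) - Complex.I • (star y * x) := by
      have hs : star (x + Complex.I • y) = star x - Complex.I • star y := by
        apply Subtype.ext
        push_cast
        simp [star_smul, sub_eq_add_neg]
      rw [hs]
      apply Subtype.ext
      push_cast
      simp only [sub_mul, mul_add, smul_mul_assoc, mul_smul_comm, smul_sub, smul_smul,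
        Complex.I_mul_I]
      module
    rw [this]; simp
  rw [him, him, him] at h1 h2
  apply Complex.ext
  · rw [Complex.conj_re]; linarith
  · rw [Complex.conj_im]; linarith

/-- The Cauchy–Schwarz inequality for positive functionals. -/
theorem IsPosFunctional.norm_sq_apply_star_mul_le {N : VonNeumannAlgebra H} {f : ↥N →ₗ[ℂ] ℂ}
    (hf : IsPosFunctional N f) (a b : ↥N) :
    ‖f (star a * b)‖ ^ 2 ≤ (f (star a * a)).re * (f (star b * b)).re := by
  let c : PreInnerProductSpace.Core ℂ ↥N :=
    { inner := fun x y => f (star x * y)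
      conj_inner_symm := hf.conj_apply_star_mul
      re_inner_nonneg := fun x => (Complex.nonneg_iff.1 (hf x)).1
      add_left := fun x y z => by rw [star_add, add_mul, map_add]
      smul_left := fun x y r => by
        have : star (r • x) * y = (starRingEnd ℂ r) • (star x * y) := by
          apply Subtype.ext
          push_cast
          simp
        rw [this, map_smul, smul_eq_mul] }
  have h := InnerProductSpace.Core.inner_mul_inner_self_le (c := c) a b
  have h' : ‖f (star a * b)‖ * ‖f (star b * a)‖ ≤ (f (star a * a)).re * (f (star b * b)).re := h
  rwa [← hf.conj_apply_star_mul a b, RCLike.norm_conj, ← pow_two,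
    ← RCLike.norm_conj, hf.conj_apply_star_mul] at h'

theorem IsPosFunctional.nonneg_of_nonneg {N : VonNeumannAlgebra H} {f : ↥N →ₗ[ℂ] ℂ}
    (hf : IsPosFunctional N f) {a : ↥N} (ha : 0 ≤ (a : H →L[ℂ] H)) : 0 ≤ f a := by
  have hsa : IsSelfAdjoint (a : H →L[ℂ] H) := IsSelfAdjoint.of_nonneg ha
  let b : ↥N := ⟨cfc Real.sqrt (a : H →L[ℂ] H), N.cfc_mem a.2 hsa _⟩
  have : star b * b = a := by
    apply Subtype.ext
    have hbs : IsSelfAdjoint (cfc Real.sqrt (a : H →L[ℂ] H)) := cfc_predicate _ _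
    change star (cfc Real.sqrt (a : H →L[ℂ] H)) * cfc Real.sqrt (a : H →L[ℂ] H) = a
    rw [hbs.star_eq, ← cfc_mul Real.sqrt Real.sqrt (a : H →L[ℂ] H)]
    conv_rhs => rw [← cfc_id' ℝ (a : H →L[ℂ] H)]
    exact cfc_congr fun t ht => Real.mul_self_sqrt (spectrum_nonneg_of_nonneg ha ht)
  rw [← this]
  exact hf b

theorem IsPosFunctional.norm_apply_le {N : VonNeumannAlgebra H} {f : ↥N →ₗ[ℂ] ℂ}
    (hf : IsPosFunctional N f) (a : ↥N) : ‖f a‖ ≤ (f 1).re * ‖(a : H →L[ℂ] H)‖ := by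
  have h1 := hf.norm_sq_apply_star_mul_le 1 a
  rw [star_one, one_mul, one_mul] at h1
  have hpos1 : 0 ≤ (f 1).re := by
    have := (Complex.nonneg_iff.1 (hf 1)).1
    rwa [star_one, one_mul] at this
  have h2 : 0 ≤ f (((‖(a : H →L[ℂ] H)‖ ^ 2 : ℝ) : ℂ) • 1 - star a * a) := by
    apply hf.nonneg_of_nonneg
    push_cast
    have := CStarAlgebra.star_mul_le_algebraMap_norm_sq (a := (a : H →L[ℂ] H))
    rw [sub_nonneg]
    refine this.trans (le_of_eq ?_)
    rw [Algebra.algebraMap_eq_smul_one]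
    norm_cast
  rw [map_sub, map_smul, smul_eq_mul] at h2
  have h3 := (Complex.nonneg_iff.1 h2).1
  rw [Complex.sub_re, Complex.re_ofReal_mul] at h3
  refine abs_le_of_sq_le_sq' ?_ (by positivity) |>.2
  nlinarith [norm_nonneg (a : H →L[ℂ] H)]

theorem IsPosFunctional.eq_zero_of_apply_one {N : VonNeumannAlgebra H} {f : ↥N →ₗ[ℂ] ℂ}
    (hf : IsPosFunctional N f) (h1 : f 1 = 0) : f = 0 := by
  ext a
  have := hf.norm_apply_le a
  rw [h1, Complex.zero_re, zero_mul] at this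
  exact norm_le_zero_iff.1 this

theorem IsPosFunctional.apply_mul_eq_zero {N : VonNeumannAlgebra H} {f : ↥N →ₗ[ℂ] ℂ}
    (hf : IsPosFunctional N f) {q : ↥N} (hq : IsStarProjection (q : H →L[ℂ] H))
    (hfq : f q = 0) (x : ↥N) : f (q * x) = 0 ∧ f (x * q) = 0 := by
  have hs : star q = q := Subtype.ext hq.isSelfAdjoint
  have hi : q * q = q := Subtype.ext hq.isIdempotentElem
  constructor
  · have := hf.norm_sq_apply_star_mul_le q x
    rw [hs, hi, hfq, Complex.zero_re, zero_mul] at this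
    exact norm_eq_zero.1 (pow_eq_zero_iff (two_ne_zero) |>.1 (le_antisymm this (by positivity)))
  · have := hf.norm_sq_apply_star_mul_le (star x) q
    rw [hs, hi, hfq, Complex.zero_re, mul_zero, star_star] at this
    exact norm_eq_zero.1 (pow_eq_zero_iff (two_ne_zero) |>.1 (le_antisymm this (by positivity)))

/-- A functional with the same value at `1` and at the projections `p n` is unchanged by
multiplication by `p n`. -/
theorem IsPosFunctional.apply_mul_eq_self {N : VonNeumannAlgebra H} {f : ↥N →ₗ[ℂ] ℂ}
    (hf : IsPosFunctional N f) {q : ↥N} (hq : IsStarProjection (q : H →L[ℂ] H))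
    (hfq : f q = f 1) (x : ↥N) : f (q * x) = f x ∧ f (x * q) = f x := by
  have h := hf.apply_mul_eq_zero (q := 1 - q) (by push_cast; exact hq.one_sub)
    (by rw [map_sub, hfq, sub_self]) x
  rw [sub_mul, mul_sub, one_mul, mul_one, map_sub, map_sub, sub_eq_zero, sub_eq_zero] at h
  exact ⟨h.1.symm, h.2.symm⟩

theorem IsPosFunctional.apply_eq_of_dominated {N : VonNeumannAlgebra H} {f g : ↥N →ₗ[ℂ] ℂ}
    (hg : IsPosFunctional N g) (hfg : IsPosFunctional N (f - g)) {q : ↥N}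
    (hq : IsStarProjection (q : H →L[ℂ] H)) (hfq : f q = f 1) : g q = g 1 := by
  have hs : star (1 - q) * (1 - q) = 1 - q := by
    apply Subtype.ext
    push_cast
    exact (hq.one_sub.isSelfAdjoint.star_eq).symm ▸ hq.one_sub.isIdempotentElem
  have h1 := hg (1 - q)
  have h2 := hfg (1 - q)
  rw [hs] at h1 h2
  rw [LinearMap.sub_apply, map_sub f, hfq, sub_self, zero_sub] at h2
  have h3 : g (1 - q) = 0 := le_antisymm (neg_nonneg.1 h2) h1
  rw [map_sub, sub_eq_zero] at h3
  exact h3.symm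

/-- A state that is one on a sequence of projections decreasing to zero is singular. -/
theorem isSingularOn_of_apply_eq_one {N : VonNeumannAlgebra H} {f : ↥N →ₗ[ℂ] ℂ}
    (hf1 : f 1 = 1) {p : ℕ → ↥N} (hp : ∀ n, IsStarProjection (p n : H →L[ℂ] H))
    (hwot : ∀ ξ η : H, Tendsto (fun n => ⟪ξ, (p n : H →L[ℂ] H) η⟫_ℂ) atTop (𝓝 0))
    (hfp : ∀ n, f (p n) = 1) : IsSingularOn N f := by
  intro g hg hfg hn
  apply hg.eq_zero_of_apply_one
  have hgp (n : ℕ) : g (p n) = g 1 :=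
    hg.apply_eq_of_dominated hfg (hp n) (by rw [hfp, hf1])
  have hlim : @Tendsto ℕ ↥N p atTop (@nhds ↥N
      (TopologicalSpace.induced (fun x : ↥N => (x : H →L[ℂ] H)) (sigmaWeak H)) 0) := by
    rw [@nhds_induced _ _ (sigmaWeak H), tendsto_comap_iff]
    unfold sigmaWeak
    simp only [nhds_iInf, tendsto_iInf, nhds_induced, tendsto_comap_iff]
    intro ξ η hξ hη
    have hsum : Summable fun k => ‖ξ k‖ * ‖η k‖ := by
      refine Summable.of_nonneg_of_le (fun k => by positivity) (fun k => ?_) (hξ.add hη)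
      nlinarith [sq_nonneg (‖ξ k‖ - ‖η k‖), sq_nonneg ‖ξ k‖, sq_nonneg ‖η k‖]
    have := tendsto_tsum_of_dominated_convergence (𝓕 := atTop)
      (f := fun n k => ⟪ξ k, (p n : H →L[ℂ] H) (η k)⟫_ℂ) (g := fun _ => 0) hsum
      (fun k => hwot (ξ k) (η k)) (Eventually.of_forall fun n k => by
        refine (norm_inner_le_norm _ _).trans ?_
        gcongr
        have := (p n : H →L[ℂ] H).le_opNorm (η k)
        have h1 : ‖(p n : H →L[ℂ] H)‖ ≤ 1 := (hp n).norm_le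
        nlinarith [norm_nonneg (η k)])
    simpa [Function.comp_def] using this
  have h2 : Tendsto (fun n => g (p n)) atTop (𝓝 (g 0)) :=
    (@Continuous.tendsto ↥N ℂ (TopologicalSpace.induced (fun x : ↥N => (x : H →L[ℂ] H))
      (sigmaWeak H)) _ g hn 0).comp hlim
  simp only [hgp, map_zero] at h2
  exact tendsto_nhds_unique tendsto_const_nhds h2

/-- The states taking the value `1` at all `p n`, as functions on `N`. -/
def statesAt (N : VonNeumannAlgebra H) (p : ℕ → ↥N) : Set (↥N → ℂ) :=
  {φ | ∃ f : ↥N →ₗ[ℂ] ℂ, φ = ⇑f ∧ IsStateOn N f ∧ ∀ n, f (p n) = 1}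

theorem isCompact_statesAt (N : VonNeumannAlgebra H) (p : ℕ → ↥N) :
    IsCompact (statesAt N p) := by
  have hK : IsCompact (Set.univ.pi fun a : ↥N =>
      Metric.closedBall (0 : ℂ) ‖(a : H →L[ℂ] H)‖) :=
    isCompact_univ_pi fun a => isCompact_closedBall _ _
  refine hK.of_isClosed_subset ?_ ?_
  · have : statesAt N p = {φ : ↥N → ℂ | (∀ a b, φ (a + b) = φ a + φ b) ∧
        (∀ (c : ℂ) a, φ (c • a) = c • φ a) ∧ (∀ a, 0 ≤ φ (star a * a)) ∧ φ 1 = 1 ∧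
        ∀ n, φ (p n) = 1} := by
      ext φ
      constructor
      · rintro ⟨f, rfl, ⟨hf, h1⟩, hp⟩
        exact ⟨map_add f, map_smul f, hf, h1, hp⟩
      · rintro ⟨hadd, hsmul, hf, h1, hp⟩
        exact ⟨⟨⟨φ, hadd⟩, hsmul⟩, rfl, ⟨hf, h1⟩, hp⟩
    rw [this]
    simp only [Set.ofPred_and, Set.ofPred_forall]
    refine IsClosed.inter (isClosed_iInter fun a => isClosed_iInter fun b =>
      isClosed_eq (by fun_prop) (by fun_prop)) (IsClosed.inter (isClosed_iInter fun a =>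
      isClosed_iInter fun b => isClosed_eq (by fun_prop) (by fun_prop))
      (IsClosed.inter (isClosed_iInter fun a => isClosed_le continuous_const (by fun_prop))
      (IsClosed.inter (isClosed_eq (by fun_prop) continuous_const)
        (isClosed_iInter fun n => isClosed_eq (by fun_prop) continuous_const))))
  · rintro _ ⟨f, rfl, ⟨hf, h1⟩, -⟩ a -
    rw [mem_closedBall_zero_iff]
    have := hf.norm_apply_le a
    rwa [h1, Complex.one_re, one_mul] at this

theorem convex_statesAt (N : VonNeumannAlgebra H) (p : ℕ → ↥N) :
    Convex ℝ (statesAt N p) := by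
  rintro _ ⟨f, rfl, ⟨hf, hf1⟩, hfp⟩ _ ⟨g, rfl, ⟨hg, hg1⟩, hgp⟩ s t hs ht hst
  have hst' : (s : ℂ) + t = 1 := by exact_mod_cast hst
  refine ⟨(s : ℂ) • f + (t : ℂ) • g, ?_, ⟨?_, ?_⟩, ?_⟩
  · ext a
    simp
  · intro a
    have hs' : (0 : ℂ) ≤ s := by exact_mod_cast hs
    have ht' : (0 : ℂ) ≤ t := by exact_mod_cast ht
    exact add_nonneg (mul_nonneg hs' (hf a)) (mul_nonneg ht' (hg a))
  · simp [hf1, hg1, hst']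
  · intro n
    simp [hfp, hgp, hst']

/-- Since `statesAt N p` is a face of the state space, its extreme points are pure states. -/
theorem isPureStateOn_of_mem_extremePoints {N : VonNeumannAlgebra H} {p : ℕ → ↥N}
    (hp : ∀ n, IsStarProjection (p n : H →L[ℂ] H)) {φ : ↥N → ℂ}
    (hφ : φ ∈ Set.extremePoints ℝ (statesAt N p)) :
    ∃ f : ↥N →ₗ[ℂ] ℂ, φ = ⇑f ∧ IsPureStateOn N f ∧ ∀ n, f (p n) = 1 := by
  obtain ⟨⟨f, rfl, hf, hfp⟩, hext⟩ := mem_extremePoints.1 hφ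
  refine ⟨f, rfl, ⟨hf, fun g hg hfg => ?_⟩, hfp⟩
  have hgp (n : ℕ) : g (p n) = g 1 := hg.apply_eq_of_dominated hfg (hp n) (by rw [hfp, hf.2])
  obtain ⟨hre, him⟩ := Complex.nonneg_iff.1 (show 0 ≤ g 1 by simpa using hg 1)
  obtain ⟨hre', him'⟩ := Complex.nonneg_iff.1 (show 0 ≤ (f - g) 1 by simpa using hfg 1)
  set t := (g 1).re with ht
  have hg1 : g 1 = (t : ℂ) := Complex.ext rfl (by simp [← him])
  have hfg1 : (f - g) 1 = ((1 - t : ℝ) : ℂ) := by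
    rw [LinearMap.sub_apply, hf.2, hg1]; push_cast; rfl
  rw [hfg1, Complex.ofReal_re] at hre'
  refine ⟨t, hre, ?_⟩
  rcases hre.eq_or_lt with h0 | h0
  · rw [← h0] at hg1 ⊢
    rw [hg.eq_zero_of_apply_one (by rw [hg1]; simp)]
    simp
  rcases hre'.eq_or_lt with h1 | h1
  · rw [← h1] at hfg1
    have := hfg.eq_zero_of_apply_one (by rw [hfg1]; simp)
    rw [sub_eq_zero] at this
    have ht1 : t = 1 := by linarith
    rw [ht1, ← this]
    simp
  have hscale (g' : ↥N →ₗ[ℂ] ℂ) (hg' : IsPosFunctional N g') (s : ℝ) (hs : 0 < s)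
      (h1 : g' 1 = (s : ℂ)) (hp' : ∀ n, g' (p n) = (s : ℂ)) :
      ⇑((s : ℂ)⁻¹ • g') ∈ statesAt N p := by
    have hs' : (s : ℂ) ≠ 0 := by exact_mod_cast hs.ne'
    refine ⟨_, rfl, ⟨fun a => ?_, ?_⟩, fun n => ?_⟩
    · have : (0 : ℂ) ≤ (s : ℂ)⁻¹ := by
        rw [← Complex.ofReal_inv]; exact_mod_cast (inv_nonneg.2 hs.le)
      exact mul_nonneg this (hg' a)
    · simp [h1, hs']
    · simp [hp', hs']
  have ht0 : (t : ℂ) ≠ 0 := by exact_mod_cast h0.ne'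
  have ht1 : ((1 - t : ℝ) : ℂ) ≠ 0 := by exact_mod_cast h1.ne'
  have key := (hext _ (hscale g hg t h0 hg1 fun n => by rw [hgp, hg1]) _
    (hscale (f - g) hfg (1 - t) h1 hfg1 fun n => by
      rw [LinearMap.sub_apply, hfp, hgp, hg1]; push_cast; rfl)
    ⟨t, 1 - t, h0, h1, by ring, by
      ext a
      simp only [Pi.add_apply, Pi.smul_apply, LinearMap.smul_apply, LinearMap.sub_apply,
        Complex.real_smul, smul_eq_mul]
      rw [mul_inv_cancel_left₀ ht0, mul_inv_cancel_left₀ ht1]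
      ring⟩).1
  have h2 : (t : ℂ)⁻¹ • g = f := DFunLike.coe_injective key
  rw [← h2, smul_smul, mul_inv_cancel₀ ht0, one_smul]

/-- The functional `x ↦ ⟪ξ, x ξ⟫` on `N`. -/
noncomputable def vectorFunctional (N : VonNeumannAlgebra H) (ξ : H) : ↥N →ₗ[ℂ] ℂ where
  toFun x := ⟪ξ, (x : H →L[ℂ] H) ξ⟫_ℂ
  map_add' x y := by simp
  map_smul' c x := by simp

theorem isStateOn_vectorFunctional (N : VonNeumannAlgebra H) {ξ : H} (hξ : ‖ξ‖ = 1) :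
    IsStateOn N (vectorFunctional N ξ) := by
  constructor
  · intro a
    change 0 ≤ ⟪ξ, (star (a : H →L[ℂ] H) * (a : H →L[ℂ] H)) ξ⟫_ℂ
    rw [mul_apply_eq_comp, ContinuousLinearMap.star_eq_adjoint,
      ContinuousLinearMap.adjoint_inner_right]
    rw [inner_self_eq_norm_sq_to_K]
    change (0 : ℂ) ≤ ((‖(a : H →L[ℂ] H) ξ‖ : ℝ) : ℂ) ^ 2
    exact_mod_cast sq_nonneg ‖(a : H →L[ℂ] H) ξ‖
  · change ⟪ξ, ξ⟫_ℂ = 1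
    rw [inner_self_eq_norm_sq_to_K, hξ]
    simp

/-- The operator norm is at most twice the numerical radius. -/
theorem ContinuousLinearMap.opNorm_le_of_norm_inner_le {E : Type*} [NormedAddCommGroup E]
    [InnerProductSpace ℂ E] (T : E →L[ℂ] E) {c : ℝ} (hc : 0 ≤ c)
    (h : ∀ v, ‖⟪T v, v⟫_ℂ‖ ≤ c * ‖v‖ ^ 2) : ‖T‖ ≤ 2 * c := by
  have hu (x y : E) (hx : ‖x‖ = 1) (hy : ‖y‖ = 1) : ‖⟪T y, x⟫_ℂ‖ ≤ 2 * c := by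
    have hp := inner_map_polarization (T : E →ₗ[ℂ] E) x y
    simp only [ContinuousLinearMap.coe_coe] at hp
    have p1 := parallelogram_law_with_norm ℂ x y
    have p2 := parallelogram_law_with_norm ℂ x (Complex.I • y)
    rw [norm_smul, Complex.norm_I, one_mul] at p2
    rw [hx, hy] at p1 p2
    have h1 := h (x + y)
    have h2 := h (x - y)
    have h3 := h (x + Complex.I • y)
    have h4 := h (x - Complex.I • y)
    rw [hp, norm_div, div_le_iff₀ (by simp)]
    refine (norm_sub_le _ _).trans ?_
    have n1 := norm_add_le (⟪T (x + y), x + y⟫_ℂ - ⟪T (x - y), x - y⟫_ℂ)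
      (Complex.I * ⟪T (x + Complex.I • y), x + Complex.I • y⟫_ℂ)
    have n2 := norm_sub_le ⟪T (x + y), x + y⟫_ℂ ⟪T (x - y), x - y⟫_ℂ
    rw [norm_mul, Complex.norm_I, one_mul] at n1 ⊢
    have : ‖(4 : ℂ)‖ = 4 := by simp
    rw [this]
    nlinarith
  refine T.opNorm_le_of_unit_norm (by positivity) fun y hy => ?_
  by_cases h0 : T y = 0
  · rw [h0, norm_zero]; positivity
  have hn : ‖T y‖ ≠ 0 := norm_ne_zero_iff.2 h0
  have := hu ((‖T y‖⁻¹ : ℂ) • T y) y (by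
    rw [norm_smul, norm_inv, Complex.norm_real, norm_norm, inv_mul_cancel₀ hn]) hy
  rw [inner_smul_right, inner_self_eq_norm_sq_to_K, norm_mul, norm_inv, Complex.norm_real,
    norm_pow, norm_norm] at this
  refine le_trans (le_of_eq ?_) this
  change _ = _ * ‖((‖T y‖ : ℝ) : ℂ)‖ ^ 2
  rw [Complex.norm_real, norm_norm]
  field_simp


theorem IsStarProjection.norm_apply_le {q : H →L[ℂ] H} (hq : IsStarProjection q) (v : H) :
    ‖q v‖ ≤ ‖v‖ := by
  have := q.le_opNorm v
  nlinarith [hq.norm_le, norm_nonneg v]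

theorem IsStarProjection.apply_apply {q : H →L[ℂ] H} (hq : IsStarProjection q) (v : H) :
    q (q v) = q v :=
  DFunLike.congr_fun hq.isIdempotentElem.eq v

theorem IsStarProjection.inner_apply_left {q : H →L[ℂ] H} (hq : IsStarProjection q) (v w : H) :
    ⟪q v, w⟫_ℂ = ⟪v, q w⟫_ℂ := by
  conv_lhs => rw [← hq.isSelfAdjoint.star_eq]
  rw [ContinuousLinearMap.star_eq_adjoint, ContinuousLinearMap.adjoint_inner_left]

theorem IsStarProjection.norm_apply_sq {q : H →L[ℂ] H} (hq : IsStarProjection q) (v : H) :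
    ‖q v‖ ^ 2 = RCLike.re ⟪q v, v⟫_ℂ := by
  rw [← inner_self_eq_norm_sq (𝕜 := ℂ), hq.inner_apply_left, hq.apply_apply, hq.inner_apply_left]

/-- A decreasing sequence of projections in `N`. -/
structure IsDecreasingProjections (N : VonNeumannAlgebra H) (p : ℕ → ↥N) : Prop where
  proj : ∀ n, IsStarProjection (p n : H →L[ℂ] H)
  mul_of_le : ∀ m n, m ≤ n → (p n : H →L[ℂ] H) * p m = p n
  ne_zero : ∀ n, (p n : H →L[ℂ] H) ≠ 0

theorem IsDecreasingProjections.mul_of_le' {N : VonNeumannAlgebra H} {p : ℕ → ↥N}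
    (hp : IsDecreasingProjections N p) {m n : ℕ} (h : m ≤ n) :
    (p m : H →L[ℂ] H) * p n = p n := by
  have := congrArg star (hp.mul_of_le m n h)
  rwa [star_mul, (hp.proj m).isSelfAdjoint.star_eq, (hp.proj n).isSelfAdjoint.star_eq] at this

theorem IsDecreasingProjections.exists_unit_vector {N : VonNeumannAlgebra H} {p : ℕ → ↥N}
    (hp : IsDecreasingProjections N p) (n : ℕ) :
    ∃ ξ : H, ‖ξ‖ = 1 ∧ (p n : H →L[ℂ] H) ξ = ξ := by
  obtain ⟨v, hv⟩ := DFunLike.ne_iff.1 (hp.ne_zero n)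
  have hn : ‖(p n : H →L[ℂ] H) v‖ ≠ 0 := norm_ne_zero_iff.2 hv
  refine ⟨((‖(p n : H →L[ℂ] H) v‖ : ℂ)⁻¹) • (p n : H →L[ℂ] H) v, ?_, ?_⟩
  · rw [norm_smul, norm_inv, Complex.norm_real, norm_norm, inv_mul_cancel₀ hn]
  · rw [map_smul, (hp.proj n).apply_apply]

theorem IsDecreasingProjections.norm_compress_antitone {N : VonNeumannAlgebra H} {p : ℕ → ↥N}
    (hp : IsDecreasingProjections N p) (z : H →L[ℂ] H) :
    Antitone fun n => ‖(p n : H →L[ℂ] H) * z * p n‖ := by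
  intro m n h
  have : (p n : H →L[ℂ] H) * z * p n =
      (p n : H →L[ℂ] H) * ((p m : H →L[ℂ] H) * z * p m) * p n := by
    calc (p n : H →L[ℂ] H) * z * p n
        = ((p n : H →L[ℂ] H) * p m) * z * ((p m : H →L[ℂ] H) * p n) := by
          rw [hp.mul_of_le m n h, hp.mul_of_le' h]
      _ = _ := by noncomm_ring
  simp only
  rw [this]
  refine (norm_mul_le _ _).trans ((mul_le_of_le_one_right (norm_nonneg _)
    (hp.proj n).norm_le).trans ((norm_mul_le _ _).trans
    (mul_le_of_le_one_left (norm_nonneg _) (hp.proj n).norm_le)))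

/-- By the Krein–Milman theorem, an element annihilated by the pure states of `statesAt N p` is
annihilated by all of them. -/
theorem IsDecreasingProjections.apply_eq_zero_of_forall_pure {N : VonNeumannAlgebra H}
    {p : ℕ → ↥N} (hp : IsDecreasingProjections N p) {z : ↥N}
    (hz : ∀ f, IsPureStateOn N f → (∀ n, f (p n) = 1) → f z = 0) {φ : ↥N → ℂ}
    (hφ : φ ∈ statesAt N p) : φ z = 0 := by
  rw [← closure_convexHull_extremePoints (isCompact_statesAt N p) (convex_statesAt N p)] at hφ
  have hcl : IsClosed {ψ : ↥N → ℂ | ψ z = 0} := isClosed_eq (by fun_prop) continuous_const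
  have hcv : Convex ℝ {ψ : ↥N → ℂ | ψ z = 0} := by
    intro a ha b hb s t _ _ _
    have ha' : a z = 0 := ha
    have hb' : b z = 0 := hb
    simp [ha', hb']
  refine closure_minimal (convexHull_min ?_ hcv) hcl hφ
  intro ψ hψ
  obtain ⟨f, rfl, hf, hfp⟩ := isPureStateOn_of_mem_extremePoints hp.proj hψ
  exact hz f hf hfp

/-- If `z` is annihilated by all pure states that are one on every `p n`, then the compressions
of `z` to `p n` tend to zero in norm. -/
theorem IsDecreasingProjections.tendsto_compress {N : VonNeumannAlgebra H}
    {p : ℕ → ↥N} (hp : IsDecreasingProjections N p) (z : ↥N)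
    (hz : ∀ f, IsPureStateOn N f → (∀ n, f (p n) = 1) → f z = 0) :
    Tendsto (fun n => (p n : H →L[ℂ] H) * z * p n) atTop (𝓝 0) := by
  rw [Metric.tendsto_atTop]
  by_contra! hcon
  obtain ⟨δ, hδ, hlarge⟩ := hcon
  have hlarge' (m : ℕ) : δ ≤ ‖(p m : H →L[ℂ] H) * z * p m‖ := by
    obtain ⟨n, hmn, hn⟩ := hlarge m
    rw [dist_zero_right] at hn
    exact hn.trans (hp.norm_compress_antitone _ hmn)
  have hvec (m : ℕ) : ∃ ξ : H, ‖ξ‖ = 1 ∧ (p m : H →L[ℂ] H) ξ = ξ ∧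
      δ / 4 ≤ ‖⟪ξ, (z : H →L[ℂ] H) ξ⟫_ℂ‖ := by
    have h1 : ∃ v, δ / 4 * ‖v‖ ^ 2 < ‖⟪((p m : H →L[ℂ] H) * z * p m) v, v⟫_ℂ‖ := by
      by_contra! h
      have := ContinuousLinearMap.opNorm_le_of_norm_inner_le _ (by positivity) h
      linarith [hlarge' m]
    obtain ⟨v, hv⟩ := h1
    set η := (p m : H →L[ℂ] H) v with hη
    have h2 : ⟪((p m : H →L[ℂ] H) * z * p m) v, v⟫_ℂ = ⟪(z : H →L[ℂ] H) η, η⟫_ℂ := by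
      simp only [mul_apply_eq_comp]
      rw [(hp.proj m).inner_apply_left]
    rw [h2] at hv
    have hle : ‖η‖ ≤ ‖v‖ := (hp.proj m).norm_apply_le v
    have hn0 : ‖η‖ ≠ 0 := by
      intro h0
      rw [norm_eq_zero] at h0
      rw [h0, inner_zero_right, norm_zero] at hv
      nlinarith [sq_nonneg ‖v‖]
    have hpos : 0 < ‖η‖ := lt_of_le_of_ne (norm_nonneg _) (Ne.symm hn0)
    refine ⟨((‖η‖ : ℂ)⁻¹) • η, ?_, ?_, ?_⟩
    · rw [norm_smul, norm_inv, Complex.norm_real, norm_norm, inv_mul_cancel₀ hn0]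
    · rw [map_smul, hη, (hp.proj m).apply_apply]
    · rw [map_smul, inner_smul_left, inner_smul_right, norm_mul, norm_mul, RCLike.norm_conj,
        norm_inv, Complex.norm_real, norm_norm, norm_inner_symm]
      have h3 : δ / 4 * ‖η‖ ^ 2 ≤ ‖⟪(z : H →L[ℂ] H) η, η⟫_ℂ‖ := by
        refine le_trans ?_ hv.le
        gcongr
      calc δ / 4 = ‖η‖⁻¹ * (‖η‖⁻¹ * (δ / 4 * ‖η‖ ^ 2)) := by field_simp
        _ ≤ _ := by gcongr
  choose ξ hξ1 hξp hξz using hvec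
  set Φ : ℕ → (↥N → ℂ) := fun m => ⇑(vectorFunctional N (ξ m)) with hΦ
  have hstate (m : ℕ) : Φ m ∈ statesAt N (fun _ => 1) :=
    ⟨_, rfl, isStateOn_vectorFunctional N (hξ1 m), fun _ =>
      (isStateOn_vectorFunctional N (hξ1 m)).2⟩
  obtain ⟨φ, hφ, hlim⟩ := (isCompact_statesAt N (fun _ => 1)).ultrafilter_le_nhds
    ((hyperfilter ℕ).map Φ) (by
      rw [le_principal_iff]
      exact Ultrafilter.mem_map.2 (Filter.univ_mem' hstate))
  have hlim' : Tendsto Φ (hyperfilter ℕ : Filter ℕ) (𝓝 φ) := hlim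
  have hev (a : ↥N) : Tendsto (fun m => Φ m a) (hyperfilter ℕ : Filter ℕ) (𝓝 (φ a)) :=
    (tendsto_pi_nhds.1 hlim') a
  have hφp (n : ℕ) : φ (p n) = 1 := by
    refine tendsto_nhds_unique (hev (p n)) (tendsto_const_nhds.congr' ?_)
    have h4 : ∀ᶠ m in (hyperfilter ℕ : Filter ℕ), n ≤ m :=
      Filter.Tendsto.eventually_ge_atTop (f := id) (Nat.hyperfilter_le_atTop) n
    filter_upwards [h4] with m hm
    change 1 = ⟪ξ m, (p n : H →L[ℂ] H) (ξ m)⟫_ℂ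
    have h5 : (p n : H →L[ℂ] H) (ξ m) = ξ m := by
      conv_lhs => rw [← hξp m]
      rw [← mul_apply_eq_comp, hp.mul_of_le' hm, hξp]
    rw [h5]
    exact ((isStateOn_vectorFunctional N (hξ1 m)).2).symm
  obtain ⟨f, rfl, hf, -⟩ := hφ
  have hfz := hp.apply_eq_zero_of_forall_pure hz (φ := f) ⟨f, rfl, hf, hφp⟩
  have h6 : δ / 4 ≤ ‖f z‖ :=
    ge_of_tendsto' (hev z).norm fun m => hξz m
  rw [hfz, norm_zero] at h6
  linarith

theorem IsStarProjection.norm_one_sub_apply_sq {q : H →L[ℂ] H} (hq : IsStarProjection q)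
    (v : H) : ‖(1 - q) v‖ ^ 2 = ‖v‖ ^ 2 - ‖q v‖ ^ 2 := by
  rw [hq.one_sub.norm_apply_sq, hq.norm_apply_sq, sub_apply, one_apply_eq_self, inner_sub_left,
    map_sub, inner_self_eq_norm_sq]

/-- If `‖e r‖` is close to `1`, some nonzero operator under `r` has range nearly fixed by `e`. -/
theorem VonNeumannAlgebra.exists_range_nearly_fixed (N : VonNeumannAlgebra H)
    {e r : H →L[ℂ] H} (he : IsStarProjection e) (heN : e ∈ N) (hr : IsStarProjection r)
    (hrN : r ∈ N) (h : 15 / 16 < ‖e * r‖ ^ 2) :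
    ∃ a ∈ N, a ≠ 0 ∧ IsSelfAdjoint a ∧ r * a = a ∧ a * r = a ∧
      ∀ v, ‖(1 - e) (a v)‖ ≤ 1 / 4 * ‖a v‖ := by
  have hy : r * e * r = star (e * r) * (e * r) := by
    rw [star_mul, he.isSelfAdjoint.star_eq, hr.isSelfAdjoint.star_eq]
    calc r * e * r = r * (e * e) * r := by rw [he.isIdempotentElem.eq]
      _ = _ := by noncomm_ring
  obtain ⟨a, b, haN, ha0, hasa, hayb, haby, hbd⟩ := N.exists_spectral_cutoff
    (y := r * e * r) (mul_mem (mul_mem hrN heN) hrN) (by rw [hy]; exact star_mul_self_nonneg _)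
    (ε := 15 / 16) (by norm_num) (by rw [hy, CStarRing.norm_star_mul_self, ← pow_two]; exact h)
  have hra : r * a = a := by
    rw [hayb]
    calc r * (r * e * r * b) = (r * r) * e * r * b := by noncomm_ring
      _ = _ := by rw [hr.isIdempotentElem.eq]
  have har : a * r = a := by
    rw [haby]
    calc b * (r * e * r) * r = b * (r * e * (r * r)) := by noncomm_ring
      _ = _ := by rw [hr.isIdempotentElem.eq]
  refine ⟨a, haN, ha0, hasa, hra, har, fun v => ?_⟩
  have h1 := hbd v
  have hrv : r (a v) = a v := DFunLike.congr_fun hra v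
  have h2 : RCLike.re ⟪(r * e * r) (a v), a v⟫_ℂ = ‖e (a v)‖ ^ 2 := by
    rw [he.norm_apply_sq]
    simp only [mul_apply_eq_comp]
    rw [hr.inner_apply_left, hrv]
  rw [h2] at h1
  refine abs_le_of_sq_le_sq' ?_ (by positivity) |>.2
  rw [he.norm_one_sub_apply_sq]
  nlinarith

theorem IsDecreasingProjections.eventually_lt_norm_mul_sub {N : VonNeumannAlgebra H}
    {p : ℕ → ↥N} (hS : ∀ v, Tendsto (fun n => (p n : H →L[ℂ] H) v) atTop (𝓝 0))
    {e : H →L[ℂ] H} {m : ℕ} (h : 1 ≤ ‖e * (p m : H →L[ℂ] H)‖) :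
    ∀ᶠ n in atTop, 15 / 16 < ‖e * ((p m : H →L[ℂ] H) - p n)‖ ^ 2 := by
  obtain ⟨ξ, hξ1, hξ⟩ := (e * (p m : H →L[ℂ] H)).exists_lt_apply_of_lt_opNorm
    (show 31 / 32 < _ by linarith)
  have hlim : Tendsto (fun n => ‖(e * ((p m : H →L[ℂ] H) - p n)) ξ‖) atTop
      (𝓝 ‖(e * (p m : H →L[ℂ] H)) ξ‖) := by
    have := (((tendsto_const_nhds (x := (p m : H →L[ℂ] H) ξ)).sub (hS ξ)))
    have h2 := ((e.continuous.tendsto _).comp this).norm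
    simpa [Function.comp_def] using h2
  filter_upwards [hlim.eventually (lt_mem_nhds hξ)] with n hn
  have := (e * ((p m : H →L[ℂ] H) - p n)).le_opNorm ξ
  nlinarith [norm_nonneg (e * ((p m : H →L[ℂ] H) - p n))]

/-- In a factor, between two projections `q` and `1 - q` that both have norm one on every `p m`,
there are norm one operators mapping nearly from `1 - q` to `q` and living under
`p m - p n`. -/
theorem IsFactor.exists_intertwining_block {N : VonNeumannAlgebra H} (hfac : IsFactor N)
    {p : ℕ → ↥N} (hp : IsDecreasingProjections N p)
    (hS : ∀ v, Tendsto (fun n => (p n : H →L[ℂ] H) v) atTop (𝓝 0))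
    {q : H →L[ℂ] H} (hq : IsStarProjection q) (hqN : q ∈ N) {m : ℕ}
    (h1 : 1 ≤ ‖q * (p m : H →L[ℂ] H)‖) (h2 : 1 ≤ ‖(1 - q) * (p m : H →L[ℂ] H)‖) :
    ∃ n, m < n ∧ ∃ T ∈ N, ‖T‖ = 1 ∧ (p m : H →L[ℂ] H) * T = T ∧ T * (p m : H →L[ℂ] H) = T ∧
      (p n : H →L[ℂ] H) * T = 0 ∧ T * (p n : H →L[ℂ] H) = 0 ∧
      ‖(1 - q) * T‖ ≤ 1 / 4 ∧ ‖T * q‖ ≤ 1 / 4 := by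
  obtain ⟨n, hn1, hn2, hmn⟩ := ((IsDecreasingProjections.eventually_lt_norm_mul_sub hS h1).and
    ((IsDecreasingProjections.eventually_lt_norm_mul_sub hS h2).and
      (eventually_gt_atTop m))).exists
  have hmn' := hp.mul_of_le' hmn.le
  have hnm' := hp.mul_of_le m n hmn.le
  have hmm := (hp.proj m).isIdempotentElem.eq
  have hnn := (hp.proj n).isIdempotentElem.eq
  set r : H →L[ℂ] H := (p m : H →L[ℂ] H) - p n with hr
  have hrp : IsStarProjection r := by
    refine ⟨?_, (hp.proj m).isSelfAdjoint.sub (hp.proj n).isSelfAdjoint⟩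
    change r * r = r
    rw [hr, sub_mul, mul_sub, mul_sub, hmn', hnm', hmm, hnn]
    abel
  have hrN : r ∈ N := sub_mem (p m).2 (p n).2
  have hmr : (p m : H →L[ℂ] H) * r = r := by rw [hr, mul_sub, hmm, hmn']
  have hrm : r * (p m : H →L[ℂ] H) = r := by rw [hr, sub_mul, hmm, hnm']
  have hnr : (p n : H →L[ℂ] H) * r = 0 := by rw [hr, mul_sub, hnn, hnm', sub_self]
  have hrn : r * (p n : H →L[ℂ] H) = 0 := by rw [hr, sub_mul, hnn, hmn', sub_self]
  obtain ⟨a, haN, ha0, hasa, hra, -, hav⟩ := N.exists_range_nearly_fixed hq hqN hrp hrN hn1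
  obtain ⟨b, hbN, hb0, hbsa, -, hbr, hbv⟩ := N.exists_range_nearly_fixed hq.one_sub
    (sub_mem (one_mem N) hqN) hrp hrN hn2
  rw [sub_sub_cancel] at hbv
  obtain ⟨w, hwN, hw⟩ := hfac.exists_mul_mul_ne_zero ha0 hbN hb0
  have hn0 : ‖a * w * b‖ ≠ 0 := norm_ne_zero_iff.2 hw
  set c : ℂ := (‖a * w * b‖ : ℂ)⁻¹ with hc
  set T : H →L[ℂ] H := a * (c • w) * b with hT
  have hTc : T = c • (a * w * b) := by rw [hT]; simp
  have hT1 : ‖T‖ = 1 := by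
    rw [hTc, norm_smul, hc, norm_inv, Complex.norm_real, norm_norm, inv_mul_cancel₀ hn0]
  have hrT : r * T = T := by rw [hT, ← mul_assoc, ← mul_assoc, hra]
  have hTr : T * r = T := by rw [hT, mul_assoc, hbr]
  refine ⟨n, hmn, T, ?_, hT1, ?_, ?_, ?_, ?_, ?_, ?_⟩
  · exact mul_mem (mul_mem haN (SMulMemClass.smul_mem c hwN)) hbN
  · rw [← hrT, ← mul_assoc, hmr]
  · rw [← hTr, mul_assoc, hrm]
  · rw [← hrT, ← mul_assoc, hnr, zero_mul]
  · rw [← hTr, mul_assoc, hrn, mul_zero]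
  · refine ContinuousLinearMap.opNorm_le_bound _ (by norm_num) fun v => ?_
    have h3 := hav ((c • w) (b v))
    have h4 : a ((c • w) (b v)) = T v := rfl
    rw [h4] at h3
    have h5 := T.le_opNorm v
    rw [hT1, one_mul] at h5
    rw [mul_apply_eq_comp]
    linarith
  · rw [← norm_star, star_mul, hq.isSelfAdjoint.star_eq]
    refine ContinuousLinearMap.opNorm_le_bound _ (by norm_num) fun v => ?_
    have hsT : star T = b * (star (c • w) * a) := by
      rw [hT, star_mul, star_mul, hasa.star_eq, hbsa.star_eq]
    have h3 := hbv ((star (c • w) * a) v)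
    have h4 : b ((star (c • w) * a) v) = star T v := by rw [hsT]; rfl
    rw [h4] at h3
    have h5 := (star T).le_opNorm v
    rw [norm_star, hT1, one_mul] at h5
    rw [mul_apply_eq_comp]
    linarith

/-- A bounded sequence of operators `T k` living under the successive differences of a decreasing
sequence of projections tending to zero can be glued to one operator. -/
theorem VonNeumannAlgebra.exists_glued_operator (N : VonNeumannAlgebra H) {P T : ℕ → H →L[ℂ] H}
    (hP : ∀ k, IsStarProjection (P k)) (hPle : ∀ k, P k * P (k + 1) = P (k + 1))
    (hS : ∀ v, Tendsto (fun k => P k v) atTop (𝓝 0))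
    (hTN : ∀ k, T k ∈ N) (hT1 : ∀ k, ‖T k‖ ≤ 1)
    (hPT : ∀ k, P k * T k = T k) (hTP : ∀ k, T k * P k = T k)
    (hPT' : ∀ k, P (k + 1) * T k = 0) (hTP' : ∀ k, T k * P (k + 1) = 0) :
    ∃ x ∈ N, ‖x‖ ≤ 1 ∧ ∀ k, x * star (T k) = T k * star (T k) := by
  have hmono (m j : ℕ) : P m * P (m + j) = P (m + j) := by
    induction j with
    | zero => exact (hP m).isIdempotentElem
    | succ j ih => rw [← add_assoc, ← hPle, ← mul_assoc, ih]
  have hmono' (m j : ℕ) : P (m + j) * P m = P (m + j) := by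
    have := congrArg star (hmono m j)
    rwa [star_mul, (hP m).isSelfAdjoint.star_eq, (hP _).isSelfAdjoint.star_eq] at this
  set X : ℕ → H →L[ℂ] H := fun n => ∑ k ∈ Finset.range n, T k with hX
  have hXs (n : ℕ) : X (n + 1) = X n + T n := Finset.sum_range_succ _ _
  have hXP (n : ℕ) : X n * P n = 0 := by
    induction n with
    | zero => simp [hX]
    | succ n ih => rw [hXs, add_mul, hTP', add_zero, ← hPle, ← mul_assoc, ih, zero_mul]
  have hPle' (k : ℕ) : P (k + 1) * P k = P (k + 1) := hmono' k 1
  have hPX (n : ℕ) : P n * X n = 0 := by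
    induction n with
    | zero => simp [hX]
    | succ n ih => rw [hXs, mul_add, hPT', add_zero, ← hPle', mul_assoc, ih, mul_zero]
  have hXn (n : ℕ) (v : H) : ‖X n v‖ ≤ ‖v‖ := by
    induction n generalizing v with
    | zero => simp [hX]
    | succ n ih =>
      have e1 : X n v = X n ((1 - P n) v) := by
        rw [← mul_apply_eq_comp, mul_sub, hXP, mul_one, sub_zero]
      have e2 : T n v = T n (P n v) := by rw [← mul_apply_eq_comp, hTP]
      have b1 := ih ((1 - P n) v)
      rw [← e1] at b1
      have b2 : ‖T n v‖ ≤ ‖P n v‖ := by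
        rw [e2]
        have := (T n).le_opNorm (P n v)
        nlinarith [hT1 n, norm_nonneg (P n v)]
      have horth : ⟪X n v, T n v⟫_ℂ = 0 := by
        rw [← hPT n, mul_apply_eq_comp, ← (hP n).inner_apply_left, ← mul_apply_eq_comp, hPX]
        simp
      have hsq := norm_add_sq_eq_norm_sq_add_norm_sq_of_inner_eq_zero (X n v) (T n v) horth
      have hv := (hP n).norm_one_sub_apply_sq v
      rw [hXs, add_apply]
      refine abs_le_of_sq_le_sq' ?_ (norm_nonneg _) |>.2
      nlinarith [norm_nonneg (X n v), norm_nonneg (T n v)]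
  have hdiff (m j : ℕ) : X (m + j) - X m = X (m + j) * P m := by
    induction j with
    | zero => rw [add_zero, sub_self, hXP]
    | succ j ih =>
      have h1 : T (m + j) * P m = T (m + j) := by
        rw [← hTP (m + j), mul_assoc, hmono']
      rw [← add_assoc, hXs, add_mul, ← ih, h1]
      abel
  have hcauchy (v : H) : CauchySeq fun n => X n v := by
    refine cauchySeq_of_le_tendsto_0' (fun n => ‖P n v‖) (fun m n hmn => ?_)
      (by simpa using (hS v).norm)
    obtain ⟨j, rfl⟩ := Nat.exists_eq_add_of_le hmn
    rw [dist_comm, dist_eq_norm, ← sub_apply, hdiff, mul_apply_eq_comp]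
    exact hXn _ _
  choose g hg using fun v => cauchySeq_tendsto_of_complete (hcauchy v)
  have hg' : Tendsto (fun n v => X n v) atTop (𝓝 g) := tendsto_pi_nhds.2 hg
  set x : H →L[ℂ] H := continuousLinearMapOfTendsto X hg' with hx
  have hxv (v : H) : Tendsto (fun n => X n v) atTop (𝓝 (x v)) := hg v
  have hXN (n : ℕ) : X n ∈ N := sum_mem fun k _ => hTN k
  refine ⟨x, ?_, ?_, fun k => ?_⟩
  · rw [← N.commutant_commutant, VonNeumannAlgebra.mem_commutant_iff]
    intro y hy
    ext v
    refine tendsto_nhds_unique ((y.continuous.tendsto _).comp (hxv v)) ((hxv (y v)).congr ?_)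
    intro n
    exact DFunLike.congr_fun (VonNeumannAlgebra.mem_commutant_iff.1 hy (X n) (hXN n)) v
  · refine ContinuousLinearMap.opNorm_le_bound _ zero_le_one fun v => ?_
    rw [one_mul]
    exact le_of_tendsto' (hxv v).norm fun n => hXn n v
  · have hPs : P k * star (T k) = star (T k) := by
      have := congrArg star (hTP k)
      rwa [star_mul, (hP k).isSelfAdjoint.star_eq] at this
    have hPs' : P (k + 1) * star (T k) = 0 := by
      have := congrArg star (hTP' k)
      rwa [star_mul, (hP _).isSelfAdjoint.star_eq, star_zero] at this
    have hconst (j : ℕ) : X (k + 1 + j) * star (T k) = T k * star (T k) := by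
      have h1 : X (k + 1 + j) = X (k + 1) + X (k + 1 + j) * P (k + 1) := by
        rw [← hdiff]; abel
      rw [h1, add_mul, mul_assoc, hPs', mul_zero, add_zero, hXs, add_mul, ← hPs, ← mul_assoc,
        hXP, zero_mul, zero_add]
    ext v
    refine tendsto_nhds_unique (hxv (star (T k) v)) (tendsto_const_nhds.congr' ?_)
    filter_upwards [eventually_ge_atTop (k + 1)] with n hn
    obtain ⟨j, rfl⟩ := Nat.exists_eq_add_of_le hn
    exact (DFunLike.congr_fun (hconst j) v).symm

/-- The operator `q` vanishes in norm along the sequence `p`. -/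
def VanishesAlong {N : VonNeumannAlgebra H} (p : ℕ → ↥N) (q : H →L[ℂ] H) : Prop :=
  Tendsto (fun n => q * (p n : H →L[ℂ] H)) atTop (𝓝 0)

theorem VanishesAlong.mul_left {N : VonNeumannAlgebra H} {p : ℕ → ↥N} {q : H →L[ℂ] H}
    (h : VanishesAlong p q) (a : H →L[ℂ] H) : VanishesAlong p (a * q) := by
  have := h.const_mul a
  rw [mul_zero] at this
  simpa only [VanishesAlong, mul_assoc] using this

theorem VanishesAlong.add {N : VonNeumannAlgebra H} {p : ℕ → ↥N} {q r : H →L[ℂ] H}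
    (hq : VanishesAlong p q) (hr : VanishesAlong p r) : VanishesAlong p (q + r) := by
  have := Tendsto.add hq hr
  rw [add_zero] at this
  simpa only [VanishesAlong, add_mul] using this

theorem VanishesAlong.eventually_norm_apply_lt {N : VonNeumannAlgebra H} {p : ℕ → ↥N}
    {q : H →L[ℂ] H} (h : VanishesAlong p q) {ε : ℝ} (hε : 0 < ε) :
    ∀ᶠ n in atTop, ∀ ξ : H, ‖ξ‖ = 1 → (p n : H →L[ℂ] H) ξ = ξ → ‖q ξ‖ < ε := by
  have := h.norm
  rw [norm_zero] at this
  filter_upwards [this.eventually (gt_mem_nhds hε)] with n hn ξ hξ hpξ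
  calc ‖q ξ‖ = ‖(q * (p n : H →L[ℂ] H)) ξ‖ := by rw [mul_apply_eq_comp, hpξ]
    _ ≤ ‖q * (p n : H →L[ℂ] H)‖ * ‖ξ‖ := ContinuousLinearMap.le_opNorm _ _
    _ < ε := by rwa [hξ, mul_one]

theorem IsDecreasingProjections.not_vanishesAlong_one {N : VonNeumannAlgebra H} {p : ℕ → ↥N}
    (hp : IsDecreasingProjections N p) : ¬ VanishesAlong p (1 : H →L[ℂ] H) := by
  intro h
  obtain ⟨n, hn⟩ := (h.eventually_norm_apply_lt one_pos).exists
  obtain ⟨ξ, hξ, hpξ⟩ := hp.exists_unit_vector n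
  have := hn ξ hξ hpξ
  rw [one_apply_eq_self, hξ] at this
  exact lt_irrefl _ this

theorem IsDecreasingProjections.vanishesAlong_of_forall_pure {N : VonNeumannAlgebra H}
    {p : ℕ → ↥N} (hp : IsDecreasingProjections N p) (q : ↥N)
    (hq : IsStarProjection (q : H →L[ℂ] H))
    (h : ∀ f, IsPureStateOn N f → (∀ n, f (p n) = 1) → f q = 0) :
    VanishesAlong p (q : H →L[ℂ] H) := by
  have h1 := (hp.tendsto_compress q h).norm
  rw [norm_zero] at h1
  have h2 (n : ℕ) : ‖(p n : H →L[ℂ] H) * q * p n‖ = ‖(q : H →L[ℂ] H) * p n‖ ^ 2 := by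
    rw [pow_two, ← CStarRing.norm_star_mul_self, star_mul, hq.isSelfAdjoint.star_eq,
      (hp.proj n).isSelfAdjoint.star_eq]
    congr 1
    calc (p n : H →L[ℂ] H) * q * p n = (p n : H →L[ℂ] H) * (q * q) * p n := by
          rw [hq.isIdempotentElem.eq]
      _ = _ := by noncomm_ring
  simp only [h2] at h1
  have h3 := h1.sqrt
  simp only [Real.sqrt_sq (norm_nonneg _), Real.sqrt_zero] at h3
  exact tendsto_zero_iff_norm_tendsto_zero.2 h3

theorem IsPureStateOn.one_le_norm_mul {N : VonNeumannAlgebra H} {f : ↥N →ₗ[ℂ] ℂ}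
    (hf : IsPureStateOn N f) {q r : ↥N} (hq : IsStarProjection (q : H →L[ℂ] H)) (hfq : f q = 1)
    (hfr : f r = 1) : 1 ≤ ‖(q : H →L[ℂ] H) * r‖ := by
  have h1 := hf.1.1.norm_apply_le (q * r)
  rw [(hf.1.1.apply_mul_eq_self hq (hfq.trans hf.1.2.symm) r).1, hfr, hf.1.2] at h1
  simpa using h1

/-- A projection of a factor on which all pure states supported on the sequence `p` are `0` or `1`
vanishes along `p`, or its complement does. -/
theorem IsFactor.vanishesAlong_or {N : VonNeumannAlgebra H} (hfac : IsFactor N)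
    {p : ℕ → ↥N} (hp : IsDecreasingProjections N p)
    (hS : ∀ v, Tendsto (fun n => (p n : H →L[ℂ] H) v) atTop (𝓝 0))
    (q : ↥N) (hq : IsStarProjection (q : H →L[ℂ] H))
    (h : ∀ f, IsPureStateOn N f → (∀ n, f (p n) = 1) → f q = 0 ∨ f q = 1) :
    VanishesAlong p (q : H →L[ℂ] H) ∨ VanishesAlong p (1 - q : H →L[ℂ] H) := by
  by_cases h0 : ∀ f, IsPureStateOn N f → (∀ n, f (p n) = 1) → f q = 0
  · exact Or.inl (hp.vanishesAlong_of_forall_pure q hq h0)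
  by_cases h1 : ∀ f, IsPureStateOn N f → (∀ n, f (p n) = 1) → f q = 1
  · refine Or.inr (hp.vanishesAlong_of_forall_pure (1 - q) hq.one_sub fun f hf hfp => ?_)
    rw [map_sub, hf.1.2, h1 f hf hfp, sub_self]
  exfalso
  push Not at h0 h1
  obtain ⟨f₁, hf₁, hf₁p, hf₁q⟩ := h0
  obtain ⟨f₀, hf₀, hf₀p, hf₀q⟩ := h1
  have hone := (h f₁ hf₁ hf₁p).resolve_left hf₁q
  have hzero := (h f₀ hf₀ hf₀p).resolve_right hf₀q
  have hblock (m : ℕ) := hfac.exists_intertwining_block hp hS hq q.2 (m := m)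
    (hf₁.one_le_norm_mul hq hone (hf₁p m))
    (hf₀.one_le_norm_mul (q := 1 - q) hq.one_sub (by rw [map_sub, hf₀.1.2, hzero, sub_zero])
      (hf₀p m))
  choose nxt hnxt T hTN hT1 hpT hTp hpT' hTp' hqT hTq using hblock
  let m : ℕ → ℕ := fun k => Nat.rec 0 (fun _ j => nxt j) k
  have hm (k : ℕ) : m (k + 1) = nxt (m k) := rfl
  have hmono : StrictMono m := strictMono_nat_of_lt_succ fun k => hnxt (m k)
  obtain ⟨x, hxN, hx1, hxT⟩ := N.exists_glued_operator (P := fun k => (p (m k) : H →L[ℂ] H))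
    (T := fun k => T (m k)) (fun k => hp.proj _) (fun k => hp.mul_of_le' (hnxt (m k)).le)
    (fun v => (hS v).comp hmono.tendsto_atTop) (fun k => hTN _) (fun k => (hT1 _).le)
    (fun k => hpT _) (fun k => hTp _) (fun k => hpT' _) (fun k => hTp' _)
  have hz := hp.tendsto_compress (q * ⟨x, hxN⟩ * (1 - q)) fun f hf hfp => by
    rcases h f hf hfp with hfq | hfq
    · rw [mul_assoc]
      exact (hf.1.1.apply_mul_eq_zero hq hfq _).1
    · exact (hf.1.1.apply_mul_eq_zero (q := 1 - q) hq.one_sub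
        (by rw [map_sub, hf.1.2, hfq, sub_self]) _).2
  have hz' := (hz.norm.comp hmono.tendsto_atTop).eventually
    (gt_mem_nhds (show ‖(0 : H →L[ℂ] H)‖ < 1 / 2 by norm_num))
  obtain ⟨k, hk⟩ := hz'.exists
  simp only [Function.comp_apply, MulMemClass.coe_mul, AddSubgroupClass.coe_sub,
    OneMemClass.coe_one] at hk
  replace hxT := hxT k
  set S := T (m k) with hSdef
  have hS1 : ‖S‖ = 1 := hT1 _
  have hSP : (p (m k) : H →L[ℂ] H) * star S = star S := by
    have := congrArg star (hTp (m k))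
    rwa [star_mul, (hp.proj _).isSelfAdjoint.star_eq] at this
  have hPS : star S * (p (m k) : H →L[ℂ] H) = star S := by
    have := congrArg star (hpT (m k))
    rwa [star_mul, (hp.proj _).isSelfAdjoint.star_eq] at this
  have e1 : ‖star S * (1 - q)‖ ≤ 1 / 4 := by
    have := hqT (m k)
    rwa [← norm_star, star_mul, hq.one_sub.isSelfAdjoint.star_eq] at this
  have e2 : ‖(q : H →L[ℂ] H) * star S‖ ≤ 1 / 4 := by
    have := hTq (m k)
    rwa [← norm_star, star_mul, hq.isSelfAdjoint.star_eq] at this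
  have e3 : 1 ≤ ‖star S * x * star S‖ := by
    have h2 : ‖star S * (S * star S) * S‖ = 1 := by
      have : star S * (S * star S) * S = star (star S * S) * (star S * S) := by
        rw [star_mul, star_star]; noncomm_ring
      rw [this, CStarRing.norm_star_mul_self, CStarRing.norm_star_mul_self, hS1]
      norm_num
    have h3 := norm_mul_le (star S * (S * star S)) S
    rw [h2, hS1, mul_one] at h3
    rwa [mul_assoc, hxT]
  set z : H →L[ℂ] H := q * x * (1 - q) with hzdef
  have e4 : star S * x * star S = star S * ((p (m k) : H →L[ℂ] H) * z * p (m k)) * star S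
      + (star S * (1 - q)) * (x * ((1 - q) * star S)) + star S * x * (q * star S) := by
    have : star S * ((p (m k) : H →L[ℂ] H) * z * p (m k)) * star S
        = (star S * p (m k)) * z * (p (m k) * star S) := by noncomm_ring
    rw [this, hSP, hPS, hzdef]
    noncomm_ring
  have hsS : ‖star S‖ = 1 := by rw [norm_star, hS1]
  have b1 : ‖star S * ((p (m k) : H →L[ℂ] H) * z * p (m k)) * star S‖
      ≤ ‖(p (m k) : H →L[ℂ] H) * z * p (m k)‖ := by
    refine (norm_mul_le _ _).trans ?_
    rw [hsS, mul_one]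
    refine (norm_mul_le _ _).trans ?_
    rw [hsS, one_mul]
  have b2 : ‖(star S * (1 - q)) * (x * ((1 - q) * star S))‖ ≤ 1 / 4 := by
    have c1 : ‖(1 - q : H →L[ℂ] H) * star S‖ ≤ 1 := by
      refine (norm_mul_le _ _).trans ?_
      rw [hsS, mul_one]
      exact hq.one_sub.norm_le
    have c2 : ‖x * ((1 - q : H →L[ℂ] H) * star S)‖ ≤ 1 :=
      (norm_mul_le _ _).trans (mul_le_one₀ hx1 (norm_nonneg _) c1)
    exact (norm_mul_le _ _).trans ((mul_le_of_le_one_right (norm_nonneg _) c2).trans e1)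
  have b3 : ‖star S * x * (q * star S)‖ ≤ 1 / 4 := by
    have c1 : ‖star S * x‖ ≤ 1 :=
      (norm_mul_le _ _).trans (mul_le_one₀ hsS.le (norm_nonneg _) hx1)
    exact (norm_mul_le _ _).trans ((mul_le_of_le_one_left (norm_nonneg _) c1).trans e2)
  rw [e4] at e3
  have := norm_add₃_le (a := star S * ((p (m k) : H →L[ℂ] H) * z * p (m k)) * star S)
    (b := (star S * (1 - q)) * (x * ((1 - q) * star S))) (c := star S * x * (q * star S))
  linarith

/-- An increasing sequence of projections in a von Neumann algebra converges strongly to a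
projection in the algebra. -/
theorem VonNeumannAlgebra.exists_strong_limit (C : VonNeumannAlgebra H) {e : ℕ → H →L[ℂ] H}
    (he : ∀ n, IsStarProjection (e n)) (heC : ∀ n, e n ∈ C) (hmono : Monotone e) :
    ∃ q ∈ C, IsStarProjection q ∧ (∀ n, e n ≤ q) ∧
      ∀ v, Tendsto (fun n => e n v) atTop (𝓝 (q v)) := by
  choose inst heq using fun n => isStarProjection_iff_eq_starProjection_range.1 (he n)
  set U : ℕ → Submodule ℂ H := fun n => (e n).range with hU
  have hUmono : Monotone U := by
    intro m n hmn
    have := hmono hmn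
    rw [heq m, heq n] at this
    exact Submodule.starProjection_le_starProjection_iff.1 this
  refine ⟨(⨆ n, U n).topologicalClosure.starProjection,
    C.starProjection_topologicalClosure_mem _ ?_, isStarProjection_starProjection,
    fun n => ?_, fun v => ?_⟩
  · intro y hy v hv
    obtain ⟨n, w, rfl⟩ := (Submodule.mem_iSup_of_directed U hUmono.directed_le).1 hv
    refine Submodule.mem_iSup_of_mem n ⟨y w, ?_⟩
    exact DFunLike.congr_fun (VonNeumannAlgebra.mem_commutant_iff.1 hy (e n) (heC n)) w
  · rw [heq n]
    exact Submodule.starProjection_le_starProjection_iff.2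
      ((le_iSup U n).trans (Submodule.le_topologicalClosure _))
  · have := Submodule.starProjection_tendsto_closure_iSup U hUmono v
    refine this.congr fun n => ?_
    rw [← heq n]

/-- From an increasing sequence of projections, keep every other successive difference. -/
theorem VonNeumannAlgebra.exists_alternating_sum (C : VonNeumannAlgebra H) {e : ℕ → H →L[ℂ] H}
    (he : ∀ n, IsStarProjection (e n)) (heC : ∀ n, e n ∈ C) (hmono : Monotone e) :
    ∃ q ∈ C, IsStarProjection q ∧
      (∀ n, q * (e (2 * n + 1) - e (2 * n)) = e (2 * n + 1) - e (2 * n)) ∧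
      ∀ n, q * (e (2 * n + 2) - e (2 * n + 1)) = 0 := by
  have hle {i j : ℕ} (h : i ≤ j) : e i * e j = e i :=
    ((he i).le_iff_mul_eq_left (he j)).1 (hmono h)
  have hle' {i j : ℕ} (h : i ≤ j) : e j * e i = e i :=
    ((he i).le_iff_mul_eq_right (he j)).1 (hmono h)
  set b : ℕ → H →L[ℂ] H := fun n => e (n + 1) - e n with hb
  have hbp (n : ℕ) : IsStarProjection (b n) :=
    ((he n).le_iff_sub (he (n + 1))).1 (hmono n.le_succ)
  have horth {i j : ℕ} (h : i ≠ j) : b i * b j = 0 := by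
    simp only [hb, sub_mul, mul_sub]
    rcases lt_or_gt_of_ne h with h | h
    · rw [hle (show i + 1 ≤ j + 1 by lia), hle (show i + 1 ≤ j by lia),
        hle (show i ≤ j + 1 by lia), hle (show i ≤ j by lia)]
      abel
    · rw [hle' (show j + 1 ≤ i + 1 by lia), hle' (show j ≤ i + 1 by lia),
        hle' (show j + 1 ≤ i by lia), hle' (show j ≤ i by lia)]
      abel
  set B : ℕ → H →L[ℂ] H := fun n => ∑ j ∈ Finset.range n, b (2 * j) with hB
  have hBeven {n j : ℕ} (h : j < n) : B n * b (2 * j) = b (2 * j) := by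
    rw [hB, Finset.sum_mul, Finset.sum_eq_single_of_mem j (Finset.mem_range.2 h),
      (hbp _).isIdempotentElem.eq]
    intro i _ hij
    exact horth (by lia)
  have hBodd (n j : ℕ) : B n * b (2 * j + 1) = 0 := by
    rw [hB, Finset.sum_mul]
    exact Finset.sum_eq_zero fun i _ => horth (by lia)
  have hBB {m n : ℕ} (h : m ≤ n) : B n * B m = B m := by
    conv_lhs => rw [hB]
    simp only
    rw [Finset.mul_sum]
    exact Finset.sum_congr rfl fun j hj => hBeven (lt_of_lt_of_le (Finset.mem_range.1 hj) h)
  have hBp (n : ℕ) : IsStarProjection (B n) :=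
    ⟨hBB le_rfl, isSelfAdjoint_sum _ fun j _ => (hbp _).isSelfAdjoint⟩
  obtain ⟨q, hqC, hq, -, hlim⟩ := C.exists_strong_limit hBp
    (fun n => sum_mem fun j _ => sub_mem (heC _) (heC _))
    (fun m n h => ((hBp m).le_iff_mul_eq_right (hBp n)).2 (hBB h))
  refine ⟨q, hqC, hq, fun n => ?_, fun n => ?_⟩
  · ext v
    refine tendsto_nhds_unique (hlim _) (tendsto_const_nhds.congr' ?_)
    filter_upwards [eventually_gt_atTop n] with m hm
    exact (DFunLike.congr_fun (hBeven hm) v).symm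
  · ext v
    refine tendsto_nhds_unique (hlim _) (tendsto_const_nhds.congr fun m => ?_)
    exact (DFunLike.congr_fun (hBodd m n) v).symm

/-- If every projection of `C` vanishes along `p` or has a vanishing complement, then the
vanishing projections of `C` are closed under increasing limits. -/
theorem IsDecreasingProjections.exists_vanishing_bound {N : VonNeumannAlgebra H} {p : ℕ → ↥N}
    (hp : IsDecreasingProjections N p) {C : VonNeumannAlgebra H}
    (hD : ∀ q ∈ C, IsStarProjection q → VanishesAlong p q ∨ VanishesAlong p (1 - q))
    {e : ℕ → H →L[ℂ] H} (he : ∀ n, IsStarProjection (e n)) (heC : ∀ n, e n ∈ C)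
    (hev : ∀ n, VanishesAlong p (e n)) (hmono : Monotone e) :
    ∃ q ∈ C, IsStarProjection q ∧ VanishesAlong p q ∧ ∀ n, e n ≤ q := by
  obtain ⟨q, hqC, hq, heq, hlim⟩ := C.exists_strong_limit he heC hmono
  refine ⟨q, hqC, hq, (hD q hqC hq).resolve_right fun hqv => ?_, heq⟩
  have hstep (k M : ℕ) : ∃ k' ≥ k, ∃ ξ : H, ‖ξ‖ = 1 ∧ (p M : H →L[ℂ] H) ξ = ξ ∧
      ‖(e k' - e k) ξ - ξ‖ < 3 / 10 := by
    obtain ⟨m, h1, h2, hm⟩ := (((hev k).eventually_norm_apply_lt (ε := 1 / 10) (by norm_num)).and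
      ((hqv.eventually_norm_apply_lt (ε := 1 / 10) (by norm_num)).and
        (eventually_ge_atTop M))).exists
    obtain ⟨ξ, hξ, hpξ⟩ := hp.exists_unit_vector m
    have h3 := (hlim ξ).eventually (Metric.ball_mem_nhds _ (show (0 : ℝ) < 1 / 10 by norm_num))
    obtain ⟨k', h4, hk'⟩ := (h3.and (eventually_ge_atTop k)).exists
    refine ⟨k', hk', ξ, hξ, ?_, ?_⟩
    · conv_lhs => rw [← hpξ]
      rw [← mul_apply_eq_comp, hp.mul_of_le' hm, hpξ]
    · rw [dist_eq_norm] at h4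
      have h5 := h1 ξ hξ hpξ
      have h6 := h2 ξ hξ hpξ
      have h7 : (e k' - e k) ξ - ξ = (e k' ξ - q ξ) - (1 - q) ξ - e k ξ := by
        simp only [sub_apply, one_apply_eq_self]
        abel
      rw [h7]
      have h8 := norm_sub_le ((e k' ξ - q ξ) - (1 - q) ξ) (e k ξ)
      have h9 := norm_sub_le (e k' ξ - q ξ) ((1 - q) ξ)
      linarith
  choose nxt hnxt ξ hξ hpξ hξe using hstep
  let K : ℕ → ℕ := fun j => Nat.rec 0 (fun j k => nxt k j) j
  have hK : Monotone K := monotone_nat_of_le_succ fun j => hnxt (K j) j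
  have hζ (j : ℕ) : ‖(e (K (j + 1)) - e (K j)) (ξ (K j) j) - ξ (K j) j‖ < 3 / 10 := hξe (K j) j
  obtain ⟨Q, hQC, hQ, heven, hodd⟩ := C.exists_alternating_sum (e := fun j => e (K j))
    (fun j => he _) (fun j => heC _) (hmono.comp hK)
  rcases hD Q hQC hQ with h | h
  all_goals
    obtain ⟨M, hM⟩ := eventually_atTop.1
      (h.eventually_norm_apply_lt (show (0 : ℝ) < 1 / 4 by norm_num))
  · have h1 := hM (2 * M) (by lia) _ (hξ (K (2 * M)) (2 * M)) (hpξ _ _)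
    have h2 := hζ (2 * M)
    have h0 := hξ (K (2 * M)) (2 * M)
    set η := ξ (K (2 * M)) (2 * M)
    set b := e (K (2 * M + 1)) - e (K (2 * M))
    have h3 : Q (b η) = b η := DFunLike.congr_fun (heven M) η
    have h4 : η = Q η + Q (b η - η) - (b η - η) := by rw [map_sub, h3]; abel
    have h5 := hQ.norm_apply_le (b η - η)
    have h6 := norm_sub_le (Q η + Q (b η - η)) (b η - η)
    have h7 := norm_add_le (Q η) (Q (b η - η))
    rw [← h4] at h6
    linarith
  · have h1 := hM (2 * M + 1) (by lia) _ (hξ (K (2 * M + 1)) (2 * M + 1)) (hpξ _ _)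
    have h2 := hζ (2 * M + 1)
    have h0 := hξ (K (2 * M + 1)) (2 * M + 1)
    set η := ξ (K (2 * M + 1)) (2 * M + 1)
    set b := e (K (2 * M + 1 + 1)) - e (K (2 * M + 1))
    have h3 : Q (b η) = 0 := DFunLike.congr_fun (hodd M) η
    have h4 : η = (1 - Q) η - Q (b η - η) := by
      rw [map_sub, h3, sub_apply, one_apply_eq_self]; abel
    have h5 := hQ.norm_apply_le (b η - η)
    have h6 := norm_sub_le ((1 - Q) η) (Q (b η - η))
    rw [← h4] at h6
    linarith

/-- A countable form of Zorn's lemma: a bounded monotone real function on a preorder in which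
increasing sequences are bounded above is eventually constant above some point. -/
theorem exists_forall_ge_apply_le_of_monotone {α : Type*} [Preorder α] [Nonempty α] {φ : α → ℝ}
    (hφ : Monotone φ) {c : ℝ} (hc : ∀ a, φ a ≤ c)
    (hseq : ∀ u : ℕ → α, Monotone u → ∃ b, ∀ n, u n ≤ b) :
    ∃ b, ∀ a, b ≤ a → φ a ≤ φ b := by
  have hbdd (a : α) : BddAbove (Set.image φ (Set.Ici a)) := ⟨c, by rintro _ ⟨x, -, rfl⟩; exact hc x⟩
  have hstep (a : α) (k : ℕ) :
      ∃ b ≥ a, sSup (Set.image φ (Set.Ici a)) - 1 / ((k : ℝ) + 1) < φ b := by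
    obtain ⟨_, ⟨b, hb, rfl⟩, h⟩ := exists_lt_of_lt_csSup (s := Set.image φ (Set.Ici a))
      ⟨_, a, Set.self_mem_Ici, rfl⟩ (sub_lt_self _ (Nat.one_div_pos_of_nat (n := k)))
    exact ⟨b, hb, h⟩
  choose nxt hnxt hlt using hstep
  let u : ℕ → α := fun k => Nat.rec (Classical.arbitrary α) (fun k a => nxt a k) k
  have hu : Monotone u := monotone_nat_of_le_succ fun k => hnxt (u k) k
  obtain ⟨b, hb⟩ := hseq u hu
  refine ⟨b, fun a hba => le_of_forall_pos_lt_add fun ε hε => ?_⟩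
  obtain ⟨k, hk⟩ := exists_nat_one_div_lt hε
  have h1 : φ a ≤ sSup (Set.image φ (Set.Ici (u k))) :=
    le_csSup (hbdd _) ⟨a, (hb k).trans hba, rfl⟩
  have h2 : sSup (Set.image φ (Set.Ici (u k))) - 1 / ((k : ℝ) + 1) < φ (u (k + 1)) := hlt (u k) k
  have h3 := hφ (hb (k + 1))
  linarith

/-- On a separable space there is a bounded strictly monotone function on projections. -/
theorem exists_strictMono_on_projections (H : Type*) [NormedAddCommGroup H]
    [InnerProductSpace ℂ H] [CompleteSpace H] [TopologicalSpace.SeparableSpace H] :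
    ∃ (φ : (H →L[ℂ] H) → ℝ) (c : ℝ), (∀ q, IsStarProjection q → φ q ≤ c) ∧
      (∀ q r, IsStarProjection q → IsStarProjection r → q ≤ r → φ q ≤ φ r) ∧
      ∀ q r, IsStarProjection q → IsStarProjection r → q ≤ r → φ r ≤ φ q → r = q := by
  set d := TopologicalSpace.denseSeq H with hd
  set w : ℕ → ℝ := fun n => (1 / 2) ^ n / (1 + ‖d n‖ ^ 2) with hw
  have hwpos (n : ℕ) : 0 < w n := by positivity
  have hle (q : H →L[ℂ] H) (hq : IsStarProjection q) (n : ℕ) :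
      w n * ‖q (d n)‖ ^ 2 ≤ (1 / 2) ^ n := by
    have h1 : ‖q (d n)‖ ^ 2 ≤ ‖d n‖ ^ 2 := by
      gcongr
      exact hq.norm_apply_le _
    rw [hw]
    simp only
    rw [div_mul_eq_mul_div]
    refine div_le_of_le_mul₀ (by positivity) (by positivity) ?_
    gcongr
    linarith
  have hsum (q : H →L[ℂ] H) (hq : IsStarProjection q) :
      Summable fun n => w n * ‖q (d n)‖ ^ 2 :=
    Summable.of_nonneg_of_le (fun n => mul_nonneg (hwpos n).le (by positivity)) (hle q hq)
      summable_geometric_two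
  have hadd (q r : H →L[ℂ] H) (hq : IsStarProjection q) (hr : IsStarProjection r) (h : q ≤ r)
      (v : H) : ‖r v‖ ^ 2 = ‖q v‖ ^ 2 + ‖(r - q) v‖ ^ 2 := by
    rw [hr.norm_apply_sq, hq.norm_apply_sq, ((hq.le_iff_sub hr).1 h).norm_apply_sq, sub_apply,
      inner_sub_left, map_sub]
    ring
  refine ⟨fun q => ∑' n, w n * ‖q (d n)‖ ^ 2, ∑' n : ℕ, (1 / 2) ^ n, fun q hq => ?_,
    fun q r hq hr h => ?_, fun q r hq hr h hφ => ?_⟩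
  · exact (hsum q hq).tsum_le_tsum (hle q hq) summable_geometric_two
  · refine (hsum q hq).tsum_le_tsum (fun n => ?_) (hsum r hr)
    refine mul_le_mul_of_nonneg_left ?_ (hwpos n).le
    rw [hadd q r hq hr h]
    exact le_add_of_nonneg_right (sq_nonneg _)
  · have hs := (hq.le_iff_sub hr).1 h
    have h1 : ∑' n, w n * ‖r (d n)‖ ^ 2
        = ∑' n, w n * ‖q (d n)‖ ^ 2 + ∑' n, w n * ‖(r - q) (d n)‖ ^ 2 := by
      rw [← (hsum q hq).tsum_add (hsum _ hs)]
      congr 1 with n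
      rw [hadd q r hq hr h, mul_add]
    have hzero (n : ℕ) : (r - q) (d n) = 0 := by
      have h2 := (hsum _ hs).le_tsum n fun j _ => mul_nonneg (hwpos j).le (by positivity)
      have h3 : w n * ‖(r - q) (d n)‖ ^ 2 ≤ 0 := by simp only at hφ; linarith
      have h4 : ‖(r - q) (d n)‖ ^ 2 ≤ 0 := nonpos_of_mul_nonpos_right h3 (hwpos n)
      exact norm_eq_zero.1 (pow_eq_zero_iff two_ne_zero |>.1 (le_antisymm h4 (sq_nonneg _)))
    rw [← sub_eq_zero]
    refine DFunLike.coe_injective (Continuous.ext_on (TopologicalSpace.denseRange_denseSeq H)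
      (r - q).continuous (0 : H →L[ℂ] H).continuous ?_)
    rintro _ ⟨n, rfl⟩
    exact hzero n

/-- If every projection of `C` vanishes along `p` or has a vanishing complement, then `C` has a
minimal projection whose complement vanishes along `p`. -/
theorem IsDecreasingProjections.exists_minimal_projection
    [TopologicalSpace.SeparableSpace H] {N : VonNeumannAlgebra H} {p : ℕ → ↥N}
    (hp : IsDecreasingProjections N p) {C : VonNeumannAlgebra H}
    (hD : ∀ q ∈ C, IsStarProjection q → VanishesAlong p q ∨ VanishesAlong p (1 - q)) :
    ∃ q ∈ C, IsStarProjection q ∧ q ≠ 0 ∧ VanishesAlong p (1 - q) ∧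
      ∀ s ∈ C, IsStarProjection s → s ≤ q → s = 0 ∨ s = q := by
  obtain ⟨φ, c, hφc, hφmono, hφstrict⟩ := exists_strictMono_on_projections H
  let α := {q : H →L[ℂ] H // q ∈ C ∧ IsStarProjection q ∧ VanishesAlong p q}
  have : Nonempty α := ⟨⟨0, zero_mem C, .zero _, by simp [VanishesAlong]⟩⟩
  obtain ⟨⟨q, hqC, hq, hqv⟩, hmax⟩ := exists_forall_ge_apply_le_of_monotone (α := α)
    (φ := fun a => φ a.1) (c := c) (fun a b hab => hφmono _ _ a.2.2.1 b.2.2.1 hab)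
    (fun a => hφc _ a.2.2.1) fun u hu => by
      obtain ⟨q, hqC, hq, hqv, hb⟩ := hp.exists_vanishing_bound hD (e := fun n => (u n).1)
        (fun n => (u n).2.2.1) (fun n => (u n).2.1) (fun n => (u n).2.2.2) (fun m n h => hu h)
      exact ⟨⟨q, hqC, hq, hqv⟩, hb⟩
  have hnv (s : H →L[ℂ] H) (hsC : s ∈ C) (hs : IsStarProjection s) (hsq : s ≤ 1 - q)
      (hsv : VanishesAlong p s) : s = 0 := by
    have h1 : s * q = 0 := by
      have := (hs.le_iff_mul_eq_left hq.one_sub).1 hsq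
      rwa [mul_sub, mul_one, sub_eq_self] at this
    have h2 : q * s = 0 := by
      have := congrArg star h1
      rwa [star_mul, hq.isSelfAdjoint.star_eq, hs.isSelfAdjoint.star_eq, star_zero] at this
    have hadd : IsStarProjection (q + s) := by
      refine ⟨?_, hq.isSelfAdjoint.add hs.isSelfAdjoint⟩
      change (q + s) * (q + s) = q + s
      rw [add_mul, mul_add, mul_add, h1, h2, hq.isIdempotentElem.eq, hs.isIdempotentElem.eq]
      abel
    have hle : q ≤ q + s := le_add_of_nonneg_right hs.nonneg
    have := hφstrict q (q + s) hq hadd hle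
      (hmax ⟨q + s, add_mem hqC hsC, hadd, hqv.add hsv⟩ hle)
    simpa using this
  refine ⟨1 - q, sub_mem (one_mem C) hqC, hq.one_sub, fun h => ?_, by rwa [sub_sub_cancel],
    fun s hsC hs hsq => ?_⟩
  · rw [← sub_eq_zero.1 h] at hqv
    exact hp.not_vanishesAlong_one hqv
  · rcases hD s hsC hs with h | h
    · exact Or.inl (hnv s hsC hs hsq h)
    · right
      have hmul := (hs.le_iff_mul_eq_right hq.one_sub).1 hsq
      have hdiff := (hs.le_iff_sub hq.one_sub).1 hsq
      have h1 : VanishesAlong p (1 - q - s) := by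
        have := h.mul_left (1 - q)
        rwa [mul_sub, mul_one, hmul] at this
      have h2 := hnv (1 - q - s) (sub_mem (sub_mem (one_mem C) hqC) hsC) hdiff
        (sub_le_self _ hs.nonneg) h1
      exact (sub_eq_zero.1 h2).symm

/-- A projection of `C` vanishing along `p` is orthogonal to every minimal projection of `C` whose
complement vanishes along `p`. -/
theorem IsDecreasingProjections.mul_eq_zero_of_vanishesAlong {N : VonNeumannAlgebra H}
    {p : ℕ → ↥N} (hp : IsDecreasingProjections N p) {C : VonNeumannAlgebra H} {q : H →L[ℂ] H}
    (hqC : q ∈ C) (hq : IsStarProjection q) (hqv : VanishesAlong p (1 - q))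
    (hmin : ∀ s ∈ C, IsStarProjection s → s ≤ q → s = 0 ∨ s = q) {e : H →L[ℂ] H}
    (heC : e ∈ C) (he : IsStarProjection e) (hev : VanishesAlong p e) : e * q = 0 := by
  have hy : q * e * q = star (e * q) * (e * q) := by
    rw [star_mul, he.isSelfAdjoint.star_eq, hq.isSelfAdjoint.star_eq]
    calc q * e * q = q * (e * e) * q := by rw [he.isIdempotentElem.eq]
      _ = _ := by noncomm_ring
  have hyv : VanishesAlong p (q * e * q) := by
    have := (hev.mul_left q).add (hqv.mul_left (-(q * e)))
    convert this using 1
    noncomm_ring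
  by_contra hne
  have hn : 0 < ‖q * e * q‖ := by
    rw [hy, CStarRing.norm_star_mul_self]
    exact mul_pos (norm_pos_iff.2 hne) (norm_pos_iff.2 hne)
  set y := q * e * q with hydef
  obtain ⟨a, b, haC, ha0, -, hayb, -, hbd⟩ := C.exists_spectral_cutoff
    (y := y) (mul_mem (mul_mem hqC heC) hqC) (by rw [hy]; exact star_mul_self_nonneg _)
    (half_pos hn) (half_lt_self hn)
  obtain ⟨s, hsC, hs, hsa, hsb, hscl⟩ := C.exists_rangeProjection haC
  have hqy : q * y = y := by rw [hydef, ← mul_assoc, ← mul_assoc, hq.isIdempotentElem.eq]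
  have hyq : y * q = y := by rw [hydef, mul_assoc, hq.isIdempotentElem.eq]
  have hsq : s = q := by
    refine (hmin s hsC hs ?_).resolve_left ?_
    · refine (hs.le_iff_mul_eq_right hq).2 ?_
      have h1 : (1 - q) * a = 0 := by
        rw [hayb, ← mul_assoc, sub_mul, one_mul, hqy, sub_self, zero_mul]
      have h2 := hsb _ h1
      rw [sub_mul, one_mul] at h2
      exact (sub_eq_zero.1 h2).symm
    · rintro rfl
      exact ha0 (by rw [← hsa, zero_mul])
  have hbelow (v : H) : ‖y‖ / 2 * ‖q v‖ ^ 2 ≤ RCLike.re ⟪y (q v), q v⟫_ℂ := by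
    have hcl : IsClosed {x : H | ‖y‖ / 2 * ‖x‖ ^ 2 ≤ RCLike.re ⟪y x, x⟫_ℂ} :=
      isClosed_le (by fun_prop) (RCLike.continuous_re.comp (by fun_prop))
    rw [← hsq]
    refine closure_minimal ?_ hcl (hscl v)
    rintro _ ⟨w, rfl⟩
    exact hbd w
  obtain ⟨m, h1, h2⟩ := ((hyv.eventually_norm_apply_lt (ε := ‖y‖ / 8) (by positivity)).and
    (hqv.eventually_norm_apply_lt (ε := 1 / 2) (by norm_num))).exists
  obtain ⟨ξ, hξ, hpξ⟩ := hp.exists_unit_vector m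
  have h3 := h1 ξ hξ hpξ
  have h4 := h2 ξ hξ hpξ
  have h5 := hbelow ξ
  have h6 : y (q ξ) = y ξ := DFunLike.congr_fun hyq ξ
  have h7 : RCLike.re ⟪y (q ξ), q ξ⟫_ℂ ≤ ‖y ξ‖ * ‖q ξ‖ := by
    rw [h6]; exact re_inner_le_norm _ _
  have h8 := hq.norm_apply_le ξ
  have h9 := hq.norm_one_sub_apply_sq ξ
  rw [hξ] at h8 h9
  have h10 : (3 : ℝ) / 4 ≤ ‖q ξ‖ ^ 2 := by nlinarith [norm_nonneg ((1 - q) ξ)]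
  nlinarith [norm_nonneg (y ξ), norm_nonneg (q ξ)]

/-- A projection that absorbs or annihilates every projection of a von Neumann algebra is
central. -/
theorem VonNeumannAlgebra.commute_of_forall_projection (C : VonNeumannAlgebra H) {q : H →L[ℂ] H}
    (hqC : q ∈ C) (hq : IsStarProjection q)
    (h : ∀ e ∈ C, IsStarProjection e → e * q = 0 ∨ e * q = q) :
    ∀ x ∈ C, q * x = x * q := by
  have hcorner (x : H →L[ℂ] H) (hx : x ∈ C) : (1 - q) * x * q = 0 := by
    set a := (1 - q) * x * q with ha
    have hqq := hq.isIdempotentElem.eq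
    have hqa : q * a = 0 := by
      rw [ha, ← mul_assoc, ← mul_assoc, hq.mul_one_sub_self, zero_mul, zero_mul]
    have haq : a * q = a := by rw [ha, mul_assoc, hqq]
    have haa : a * a = 0 := by
      nth_rewrite 1 [← haq]
      rw [mul_assoc, hqa, mul_zero]
    have hbC : q + a ∈ C :=
      add_mem hqC (mul_mem (mul_mem (sub_mem (one_mem C) hqC) hx) hqC)
    obtain ⟨e, heC, he, heb, hker, -⟩ := C.exists_rangeProjection hbC
    have hbe : (q + a) * e = e := by
      have h1 : (1 - (q + a)) * (q + a) = 0 := by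
        have : (1 - (q + a)) * (q + a) = q + a - (q * q + q * a + a * q + a * a) := by
          noncomm_ring
        rw [this, hqq, hqa, haq, haa]
        abel
      have h2 := hker _ h1
      rw [sub_mul, one_mul] at h2
      exact (sub_eq_zero.1 h2).symm
    rcases h e heC he with h0 | h1
    · have hqe : q * e = 0 := by
        have := congrArg star h0
        rwa [star_mul, hq.isSelfAdjoint.star_eq, he.isSelfAdjoint.star_eq, star_zero] at this
      have hq0 : q = 0 := by
        calc q = q * (q + a) := by rw [mul_add, hqq, hqa, add_zero]
          _ = q * e * (q + a) := by rw [mul_assoc, heb]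
          _ = 0 := by rw [hqe, zero_mul]
      rw [← haq, hq0, mul_zero]
    · have h2 : (q + a) * q = q := by
        nth_rewrite 2 [← h1]
        rw [← mul_assoc, hbe, h1]
      rwa [add_mul, hqq, haq, add_eq_left] at h2
  intro x hx
  have h1 := hcorner x hx
  have h2 := congrArg star (hcorner (star x) (star_mem hx))
  rw [star_mul, star_mul, star_star, star_zero, hq.isSelfAdjoint.star_eq,
    hq.one_sub.isSelfAdjoint.star_eq, ← mul_assoc, mul_sub, mul_one, sub_eq_zero] at h2
  rw [sub_mul, sub_mul, one_mul, sub_eq_zero] at h1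
  rw [h2, ← h1]

theorem IsDecreasingProjections.commute_minimal_projection {N : VonNeumannAlgebra H}
    {p : ℕ → ↥N} (hp : IsDecreasingProjections N p) {C : VonNeumannAlgebra H}
    (hD : ∀ q ∈ C, IsStarProjection q → VanishesAlong p q ∨ VanishesAlong p (1 - q))
    {q : H →L[ℂ] H} (hqC : q ∈ C) (hq : IsStarProjection q) (hqv : VanishesAlong p (1 - q))
    (hmin : ∀ s ∈ C, IsStarProjection s → s ≤ q → s = 0 ∨ s = q) :
    ∀ x ∈ C, q * x = x * q := by
  refine C.commute_of_forall_projection hqC hq fun e heC he => ?_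
  rcases hD e heC he with h | h
  · exact Or.inl (hp.mul_eq_zero_of_vanishesAlong hqC hq hqv hmin heC he h)
  · right
    have := hp.mul_eq_zero_of_vanishesAlong hqC hq hqv hmin (sub_mem (one_mem C) heC)
      he.one_sub h
    rw [sub_mul, one_mul, sub_eq_zero] at this
    exact this.symm

theorem IsProjection.isStarProjection {p : H →L[ℂ] H} (hp : IsProjection p) :
    IsStarProjection p :=
  ⟨hp.2, hp.1⟩

theorem IsStarProjection.isProjection {p : H →L[ℂ] H} (hp : IsStarProjection p) :
    IsProjection p :=
  ⟨hp.isSelfAdjoint, hp.isIdempotentElem⟩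

theorem isDecreasingProjections_of_projLE {N : VonNeumannAlgebra H} {p : ℕ → ↥N}
    (hproj : ∀ n, IsProjection ((p n : H →L[ℂ] H))) (hne : ∀ n, (p n : H →L[ℂ] H) ≠ 0)
    (hdec : ∀ n, ProjLE ((p (n + 1) : H →L[ℂ] H)) ((p n : H →L[ℂ] H))) :
    IsDecreasingProjections N p := by
  refine ⟨fun n => (hproj n).isStarProjection, fun m n h => ?_, hne⟩
  induction n, h using Nat.le_induction with
  | base => exact (hproj m).2
  | succ n _ ih => rw [← (hdec n).1, mul_assoc, ih]

theorem IsDecreasingProjections.tendsto_apply_zero {N : VonNeumannAlgebra H} {p : ℕ → ↥N}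
    (hp : IsDecreasingProjections N p)
    (hwot : ∀ ξ η : H, Tendsto (fun n => ⟪ξ, (p n : H →L[ℂ] H) η⟫_ℂ) atTop (𝓝 0)) (v : H) :
    Tendsto (fun n => (p n : H →L[ℂ] H) v) atTop (𝓝 0) := by
  have h1 := (RCLike.continuous_re.tendsto (0 : ℂ)).comp (hwot v v)
  have h2 (n : ℕ) : RCLike.re ⟪v, (p n : H →L[ℂ] H) v⟫_ℂ = ‖(p n : H →L[ℂ] H) v‖ ^ 2 := by
    rw [(hp.proj n).norm_apply_sq, (hp.proj n).inner_apply_left]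
  simp only [Function.comp_def, h2, map_zero] at h1
  have h3 := h1.sqrt
  simp only [Real.sqrt_sq (norm_nonneg _), Real.sqrt_zero] at h3
  exact tendsto_zero_iff_norm_tendsto_zero.2 h3

theorem IsDecreasingProjections.exists_pure_state {N : VonNeumannAlgebra H} {p : ℕ → ↥N}
    (hp : IsDecreasingProjections N p) :
    ∃ f, IsPureStateOn N f ∧ ∀ n, f (p n) = 1 := by
  by_contra! h
  refine hp.not_vanishesAlong_one (hp.vanishesAlong_of_forall_pure 1 (.one _) fun f hf hfp => ?_)
  obtain ⟨n, hn⟩ := h f hf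
  exact absurd (hfp n) hn

theorem IsPureStateOn.apply_eq_zero_of_vanishesAlong {N : VonNeumannAlgebra H} {p : ℕ → ↥N}
    (hp : IsDecreasingProjections N p) {f : ↥N →ₗ[ℂ] ℂ} (hf : IsPureStateOn N f)
    (hfp : ∀ n, f (p n) = 1) {q : ↥N} (hq : VanishesAlong p (q : H →L[ℂ] H)) : f q = 0 := by
  have h1 (n : ℕ) : ‖f q‖ ≤ ‖(q : H →L[ℂ] H) * p n‖ := by
    rw [← (hf.1.1.apply_mul_eq_self (hp.proj n) ((hfp n).trans hf.1.2.symm) q).2]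
    have := hf.1.1.norm_apply_le (q * p n)
    rw [hf.1.2] at this
    simpa using this
  have h2 := hq.norm
  rw [norm_zero] at h2
  exact norm_le_zero_iff.1 (ge_of_tendsto' h2 h1)

/-- Key lemma: if `N` is an infinite-dimensional factor on a separable Hilbert space,
`(p n)` is a decreasing sequence of nonzero projections in `N` converging to `0` in the
weak operator topology, and `C` is a von Neumann subalgebra of `N`, then there are a
singular pure state `f` on `N` with `f (p n) = 1` for all `n` and a projection `q ∈ C`
with either `0 < f q < 1`, or `q` minimal in `C`, central in `C`, and `f q = 1`. -/
theorem exists_singular_pure_state_with_projection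
    [TopologicalSpace.SeparableSpace H]
    (N : VonNeumannAlgebra H) (hfac : IsFactor N) (hinf : ¬ FiniteDimensional ℂ ↥N)
    (p : ℕ → ↥N)
    (hproj : ∀ n, IsProjection ((p n : H →L[ℂ] H)))
    (hne : ∀ n, (p n : H →L[ℂ] H) ≠ 0)
    (hdec : ∀ n, ProjLE ((p (n + 1) : H →L[ℂ] H)) ((p n : H →L[ℂ] H)))
    (hwot : ∀ ξ η : H, Tendsto (fun n => ⟪ξ, (p n : H →L[ℂ] H) η⟫_ℂ) atTop (𝓝 0))
    (C : VonNeumannAlgebra H) (hC : (C : Set (H →L[ℂ] H)) ⊆ N) :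
    ∃ (f : ↥N →ₗ[ℂ] ℂ) (q : ↥N),
      IsPureStateOn N f ∧ IsSingularOn N f ∧ (∀ n, f (p n) = 1) ∧
      (q : H →L[ℂ] H) ∈ C ∧ IsProjection ((q : H →L[ℂ] H)) ∧
      ((0 < f q ∧ f q < 1) ∨
        (IsMinimalProjectionIn (C : Set (H →L[ℂ] H)) ((q : H →L[ℂ] H)) ∧
          (∀ x ∈ C, (q : H →L[ℂ] H) * x = x * q) ∧ f q = 1)) := by
  have hp := isDecreasingProjections_of_projLE hproj hne hdec
  have hS := hp.tendsto_apply_zero hwot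
  have hsing {f : ↥N →ₗ[ℂ] ℂ} (hf : IsPureStateOn N f) (hfp : ∀ n, f (p n) = 1) :
      IsSingularOn N f := isSingularOn_of_apply_eq_one hf.1.2 hp.proj hwot hfp
  by_cases hex : ∃ (f : ↥N →ₗ[ℂ] ℂ) (q : ↥N), IsPureStateOn N f ∧ (∀ n, f (p n) = 1) ∧
      (q : H →L[ℂ] H) ∈ C ∧ IsStarProjection (q : H →L[ℂ] H) ∧ 0 < f q ∧ f q < 1
  · obtain ⟨f, q, hf, hfp, hqC, hq, h0, h1⟩ := hex
    exact ⟨f, q, hf, hsing hf hfp, hfp, hqC, hq.isProjection, Or.inl ⟨h0, h1⟩⟩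
  have hD (q : H →L[ℂ] H) (hqC : q ∈ C) (hq : IsStarProjection q) :
      VanishesAlong p q ∨ VanishesAlong p (1 - q) := by
    refine hfac.vanishesAlong_or hp hS ⟨q, hC hqC⟩ hq fun f hf hfp => ?_
    by_contra! hne
    have h0 : 0 ≤ f ⟨q, hC hqC⟩ := hf.1.1.nonneg_of_nonneg hq.nonneg
    have h1 : 0 ≤ f (1 - ⟨q, hC hqC⟩) := hf.1.1.nonneg_of_nonneg hq.one_sub.nonneg
    rw [map_sub, hf.1.2, sub_nonneg] at h1
    exact hex ⟨f, ⟨q, hC hqC⟩, hf, hfp, hqC, hq, lt_of_le_of_ne h0 hne.1.symm,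
      lt_of_le_of_ne h1 hne.2⟩
  obtain ⟨q, hqC, hq, hq0, hqv, hmin⟩ := hp.exists_minimal_projection hD
  obtain ⟨f, hf, hfp⟩ := hp.exists_pure_state
  have hfq : f (1 - ⟨q, hC hqC⟩) = 0 := hf.apply_eq_zero_of_vanishesAlong hp hfp hqv
  rw [map_sub, hf.1.2, sub_eq_zero] at hfq
  refine ⟨f, ⟨q, hC hqC⟩, hf, hsing hf hfp, hfp, hqC, hq.isProjection, Or.inr
    ⟨⟨hqC, hq.isProjection, hq0, fun s hsC hs hsq => hmin s hsC hs.isStarProjection ?_⟩,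
      hp.commute_minimal_projection hD hqC hq hqv hmin, hfq.symm⟩⟩
  exact (hs.isStarProjection.le_iff_mul_eq_left hq).2 hsq.1
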